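/- arXiv:math/9706219 — 2 statements merged into one kernel-verified Lean document; each statement's English description precedes it below -/
import Mathlib

section
/- For σ ∈ S_n define stat(σ) := Σ_{i: σ_i>i} (σ_i - i) + Σ_{i: σ_i ≤ i} (1 - σ_i) + #{1≤i<j≤n : σ_i > σ_j > j} + #{1≤i<j≤n : σ_i ≤ j and σ_i < σ_j}. Then (exc, stat) is jointly equidistributed with (des, maj) on S_n: Σ_{σ: exc(σ)=k} q^{stat(σ)} = Σ_{σ: des(σ)=k} q^{maj(σ)} for every k. -/
open Finset
open scoped Classical

noncomputable section

variable {R : Type*} [CommRing R]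

/-- The q-integer `[m]_q = 1 + q + ... + q^{m-1}`. -/
def qint (q : R) (m : ℕ) : R := ∑ i ∈ Finset.range m, q ^ i

/-- The q-factorial `[m]_q!`. -/
def qfact (q : R) (m : ℕ) : R := ∏ i ∈ Finset.range m, qint q (i + 1)

/-- A Ferrers board inside the `n × n` grid, given by column heights `c`:
square `(i,j)` (0-based row `i`, column `j`) belongs to the board iff `i < c j`. -/
def IsFerrers (n : ℕ) (c : Fin n → ℕ) : Prop := Monotone c ∧ ∀ j, c j ≤ n

/-- The squares of the Ferrers board with column heights `c`. -/
def boardSq (n : ℕ) (c : Fin n → ℕ) : Finset (Fin n × Fin n) :=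
  Finset.univ.filter fun s => (s.1 : ℕ) < c s.2

/-- A set of rooks is non-attacking when no two share a row or a column. -/
def NonAttacking {n : ℕ} (C : Finset (Fin n × Fin n)) : Prop :=
  ∀ r ∈ C, ∀ r' ∈ C, r ≠ r' → r.1 ≠ r'.1 ∧ r.2 ≠ r'.2

/-- Placements of `k` non-attacking rooks on the Ferrers board. -/
def placements (n : ℕ) (c : Fin n → ℕ) (k : ℕ) : Finset (Finset (Fin n × Fin n)) :=
  Finset.univ.filter fun C => C.card = k ∧ C ⊆ boardSq n c ∧ NonAttacking C

/-- `inv(C,B)`: the number of squares of the board that do not contain a rook and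
are not above (smaller row index, same column) nor to the right of (same row,
larger column index) any rook of `C`. -/
def rookInv (n : ℕ) (c : Fin n → ℕ) (C : Finset (Fin n × Fin n)) : ℕ :=
  ((boardSq n c).filter fun s => s ∉ C ∧ ∀ r ∈ C,
    ¬(r.2 = s.2 ∧ s.1 < r.1) ∧ ¬(r.1 = s.1 ∧ r.2 < s.2)).card

/-- The Garsia–Remmel q-rook polynomial `R_k(B;q)`. -/
def qRook (q : R) (n : ℕ) (c : Fin n → ℕ) (k : ℕ) : R :=
  ∑ C ∈ placements n c k, q ^ rookInv n c C

/-- The polynomial (in `x`) `∑_{j=0}^n [j]_q! R_{n-j}(B;q) ∏_{i=j+1}^n (x - q^i)`. -/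
def hitGen (q : R) (n : ℕ) (c : Fin n → ℕ) : Polynomial R :=
  ∑ j ∈ Finset.range (n + 1),
    Polynomial.C (qfact q j * qRook q n c (n - j)) *
      ∏ i ∈ Finset.Icc (j + 1) n, (Polynomial.X - Polynomial.C (q ^ i))

/-- The Garsia–Remmel q-hit polynomial `T_k(B;q)`, defined by
`∑_{j=0}^n [j]_q! R_{n-j}(B;q) ∏_{i=j+1}^n (x - q^i) = ∑_k T_k(B;q) x^k`. -/
def qHit (q : R) (n : ℕ) (c : Fin n → ℕ) (k : ℕ) : R := (hitGen q n c).coeff k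

/-- Placements of `n` non-attacking rooks on the full `n × n` grid with exactly
`k` rooks on the board. -/
def fullPlacements (n : ℕ) (c : Fin n → ℕ) (k : ℕ) : Finset (Finset (Fin n × Fin n)) :=
  Finset.univ.filter fun C => C.card = n ∧ NonAttacking C ∧ (C ∩ boardSq n c).card = k

end

noncomputable section

/-- The descent set of a permutation of `Fin n` (0-based positions). -/
def descSet {n : ℕ} (σ : Equiv.Perm (Fin n)) : Finset (Fin n) :=
  Finset.univ.filter fun i => ∃ h : (i : ℕ) + 1 < n, σ ⟨(i : ℕ) + 1, h⟩ < σ i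

/-- The number of descents. -/
def desStat {n : ℕ} (σ : Equiv.Perm (Fin n)) : ℕ := (descSet σ).card

/-- The major index (descent positions counted 1-based). -/
def majStat {n : ℕ} (σ : Equiv.Perm (Fin n)) : ℕ := ∑ i ∈ descSet σ, ((i : ℕ) + 1)

end

noncomputable section

/-- The number of excedences of a permutation (1-based: `σ_i > i`). -/
def excStat {n : ℕ} (σ : Equiv.Perm (Fin n)) : ℕ :=
  (Finset.univ.filter fun i : Fin n => i < σ i).card

/-- The statistic of Theorem 5(a) (stated 1-based in the paper; here 0-based,
so `σ_i - i` is unchanged and `1 - σ_i` becomes `-(σ i)`). -/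
def statA {n : ℕ} (σ : Equiv.Perm (Fin n)) : ℤ :=
  (∑ i ∈ Finset.univ.filter (fun i : Fin n => i < σ i), ((σ i : ℤ) - (i : ℤ))) +
    (∑ i ∈ Finset.univ.filter (fun i : Fin n => σ i ≤ i), (-(σ i : ℤ))) +
    ((Finset.univ.filter fun p : Fin n × Fin n =>
        p.1 < p.2 ∧ σ p.2 < σ p.1 ∧ p.2 < σ p.2).card : ℤ) +
    ((Finset.univ.filter fun p : Fin n × Fin n =>
        p.1 < p.2 ∧ (σ p.1 : ℕ) ≤ (p.2 : ℕ) ∧ σ p.1 < σ p.2).card : ℤ)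

end

/-- The `p`-bracket `[z]_p` of an integer `z`. -/
noncomputable def zBracket (p : ℚ) (z : ℤ) : ℚ := if p = 1 then z else (1 - p ^ z) / (1 - p)

theorem one_sub_mul_zBracket (p : ℚ) (z : ℤ) : (1 - p) * zBracket p z = 1 - p ^ z := by
  unfold zBracket
  split_ifs with h
  · simp [h]
  · have : 1 - p ≠ 0 := sub_ne_zero.2 (Ne.symm h)
    field_simp

theorem zpow_eq_zBracket (p : ℚ) (z : ℤ) : p ^ z = 1 - (1 - p) * zBracket p z := by
  rw [one_sub_mul_zBracket]; ring

theorem zBracket_add {p : ℚ} (hp : p ≠ 0) (x y : ℤ) :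
    zBracket p (x + y) = zBracket p x + p ^ x * zBracket p y := by
  by_cases h : p = 1
  · simp [zBracket, h]
  · have h' : 1 - p ≠ 0 := sub_ne_zero.2 (Ne.symm h)
    apply mul_left_cancel₀ h'
    rw [mul_add, mul_left_comm, one_sub_mul_zBracket, one_sub_mul_zBracket,
      one_sub_mul_zBracket, zpow_add₀ hp]
    ring

@[simp] theorem zBracket_zero (p : ℚ) : zBracket p 0 = 0 := by simp [zBracket]

@[simp] theorem zBracket_one (p : ℚ) : zBracket p 1 = 1 := by
  unfold zBracket
  split_ifs with h
  · simp
  · have : 1 - p ≠ 0 := sub_ne_zero.2 (Ne.symm h)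
    simp [this]

theorem zBracket_natCast {p : ℚ} (hp : p ≠ 0) (n : ℕ) :
    zBracket p n = ∑ i ∈ Finset.range n, p ^ i := by
  induction n with
  | zero => simp
  | succ n ih =>
    rw [Nat.cast_succ, zBracket_add hp, ih, Finset.sum_range_succ]
    simp

theorem zBracket_add_one {p : ℚ} (hp : p ≠ 0) (z : ℤ) :
    zBracket p (z + 1) = 1 + p * zBracket p z := by
  rw [add_comm, zBracket_add hp]; simp

theorem zBracket_eq_zpow_mul_zBracket_inv {q : ℚ} (hq : q ≠ 0) (z : ℤ) :
    zBracket q z = q ^ (z - 1) * zBracket q⁻¹ z := by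
  by_cases h : q = 1
  · simp [zBracket, h]
  · have h' : 1 - q ≠ 0 := sub_ne_zero.2 (Ne.symm h)
    apply mul_left_cancel₀ h'
    have h1 := one_sub_mul_zBracket q⁻¹ z
    have h2 : q ^ z * (q⁻¹) ^ z = 1 := by
      rw [inv_zpow, mul_inv_cancel₀ (zpow_ne_zero _ hq)]
    have h3 : q ^ z = q ^ (z - 1) * q := by rw [← zpow_add_one₀ hq, sub_add_cancel]
    have h4 : q * q⁻¹ = 1 := mul_inv_cancel₀ hq
    rw [one_sub_mul_zBracket]
    linear_combination q ^ z * h1 - h2 + (zBracket q⁻¹ z * q⁻¹ - zBracket q⁻¹ z) * h3 +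
      q ^ (z - 1) * zBracket q⁻¹ z * h4

/-- Total weight of the Laguerre histories of length `n` with `b` closed and `d` open arcs,
where `p = q⁻¹`. -/
noncomputable def histWeight (q : ℚ) : ℕ → ℤ → ℤ → ℚ
  | 0, b, d => if b = 0 ∧ d = 0 then 1 else 0
  | n + 1, b, d =>
    (histWeight q n b (d - 1) + q ^ n * zBracket q⁻¹ d * histWeight q n (b - 1) d) +
      zBracket q⁻¹ (d + 1) * (histWeight q n b d +
        q ^ n * zBracket q⁻¹ (d + 1) * histWeight q n (b - 1) (d + 1))

theorem histWeight_eq_zero_of_neg (q : ℚ) (n : ℕ) (b d : ℤ) (h : b < 0 ∨ d < 0) :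
    histWeight q n b d = 0 := by
  induction n generalizing b d with
  | zero => simp [histWeight]; omega
  | succ n ih =>
    rw [histWeight, ih b (d - 1) (by omega), ih (b - 1) d (by omega), ih b d h]
    by_cases hd : d = -1
    · simp [hd]
    · rw [ih (b - 1) (d + 1) (by omega)]; ring

theorem histWeight_eq_zero_of_lt (q : ℚ) (n : ℕ) (b d : ℤ) (h : n < b + d) :
    histWeight q n b d = 0 := by
  induction n generalizing b d with
  | zero => simp [histWeight]; push_cast at h; omega
  | succ n ih =>
    push_cast at h
    rw [histWeight, ih b (d - 1) (by omega), ih (b - 1) d (by omega), ih b d (by omega),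
      ih (b - 1) (d + 1) (by omega)]
    ring

theorem histWeight_open_succ {q : ℚ} (hq : q ≠ 0) (n : ℕ) (b d : ℤ) :
    zBracket q⁻¹ (d + 1) ^ 2 * histWeight q n b (d + 1) =
      q ^ (b + 1 - n) * zBracket q⁻¹ (b + 1) * histWeight q n (b + 1) d +
        q ^ (-d) * zBracket q⁻¹ (n - b - d) * histWeight q n b d := by
  induction n generalizing b d with
  | zero =>
    simp only [histWeight]
    by_cases h1 : b = 0 ∧ d + 1 = 0
    · obtain ⟨rfl, h⟩ := h1
      simp [h]; omega
    · by_cases h2 : b + 1 = 0 ∧ d = 0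
      · simp [h2]; omega
      · by_cases h3 : b = 0 ∧ d = 0
        · simp [h3]
        · simp [h1, h2, h3]
  | succ n ih =>
    have hp : q⁻¹ ≠ 0 := inv_ne_zero hq
    have i1 := ih b d
    have i2 := ih (b - 1) (d + 1)
    have i3 := ih b (d - 1)
    have i4 := ih (b - 1) d
    have e3 : (n : ℤ) - (b - 1) - (d + 1) = n - b - d := by ring
    have e4 : (n : ℤ) - b - (d - 1) = (n - b - d) + 1 := by ring
    have e5 : (n : ℤ) - (b - 1) - d = (n - b - d) + 1 := by ring
    have e6 : ((n + 1 : ℕ) : ℤ) - b - d = (n - b - d) + 1 := by push_cast; ring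
    have hU : q ^ b * (1 - (1 - q⁻¹) * zBracket q⁻¹ b) = 1 := by
      rw [← zpow_eq_zBracket, inv_zpow, mul_inv_cancel₀ (zpow_ne_zero _ hq)]
    have hD : q ^ (-d) = 1 - (1 - q⁻¹) * zBracket q⁻¹ d := by
      rw [← zpow_eq_zBracket, inv_zpow, zpow_neg]
    have z1 : q ^ (b + 1 - n) = q ^ b * q * (q ^ n)⁻¹ := by
      rw [zpow_sub₀ hq, zpow_add_one₀ hq, zpow_natCast]; rfl
    have z2 : q ^ (b - n) = q ^ b * (q ^ n)⁻¹ := by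
      rw [zpow_sub₀ hq, zpow_natCast]; rfl
    have z3 : q ^ (-(d + 1)) = q ^ (-d) * q⁻¹ := by
      rw [neg_add, zpow_add₀ hq, zpow_neg_one]
    have z4 : q ^ (-(d - 1)) = q ^ (-d) * q := by
      rw [neg_sub, sub_eq_neg_add, zpow_add₀ hq, zpow_one]
    have z5 : q ^ (b + 1 - (n + 1 : ℕ)) = q ^ b * (q ^ n)⁻¹ := by
      rw [← z2]; congr 1; push_cast; ring
    simp only [histWeight]
    simp only [z1, z2, z3, z4, z5, e3, e4, e5, e6, sub_add_cancel, add_sub_cancel_right,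
      zBracket_add_one hp]
      at i1 i2 i3 i4 ⊢
    have hqp : q * q⁻¹ = 1 := mul_inv_cancel₀ hq
    have hP : q ^ n * (q ^ n)⁻¹ = 1 := mul_inv_cancel₀ (pow_ne_zero _ hq)
    simp only [hD] at i1 i2 i3 i4 ⊢
    generalize hB : zBracket q⁻¹ b = B at *
    generalize hDD : zBracket q⁻¹ d = D at *
    generalize zBracket q⁻¹ (n - b - d) = N at *
    generalize q ^ b = U at *
    generalize (q ^ n)⁻¹ = Pi at *
    generalize q ^ n = P at *
    generalize q⁻¹ = p at *
    linear_combination (p * (1 + p * D)) * i1 + (P * (1 + p * D) ^ 2) * i2 + p * i3 +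
      (P * D) * i4 - ((1 + p * D) ^ 2 * histWeight q n b (d + 1) + D * histWeight q n b d) * hU +
      (U * (B - (1 + p * B)) *
        (D * histWeight q n b d + (1 + p * D) ^ 2 * histWeight q n b (d + 1))) * hP +
      ((1 + p * D) * U * Pi * (1 + p * B) * histWeight q n (b + 1) d +
        U * Pi * (1 + p * B) * histWeight q n (b + 1) (d - 1) +
        (1 - (1 - p) * D) * (1 + p * N) * histWeight q n b (d - 1)) * hqp
theorem histWeight_succ_zero {q : ℚ} (hq : q ≠ 0) (n : ℕ) (k : ℤ) :
    histWeight q (n + 1) k 0 =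
      zBracket q (k + 1) * histWeight q n k 0 +
        q ^ k * zBracket q (n + 1 - k) * histWeight q n (k - 1) 0 := by
  have h := histWeight_open_succ hq n (k - 1) 0
  rw [histWeight, histWeight_eq_zero_of_neg q n k (0 - 1) (by omega), zBracket_zero, zero_add,
    zero_add, zBracket_one]
  simp only [zero_add, zBracket_one, one_pow, one_mul, sub_add_cancel, neg_zero, zpow_zero,
    sub_zero] at h
  rw [h, zBracket_add_one hq, zBracket_eq_zpow_mul_zBracket_inv hq k,
    zBracket_eq_zpow_mul_zBracket_inv hq (n + 1 - k), show (n : ℤ) - (k - 1) = n + 1 - k by ring]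
  have z1 : q * q ^ (k - 1) = q ^ k := by rw [← zpow_one_add₀ hq]; congr 1; ring
  have z2 : q ^ k * q ^ ((n : ℤ) + 1 - k - 1) = q ^ n := by
    rw [← zpow_add₀ hq, ← zpow_natCast]; congr 1; ring
  have z3 : q ^ n * q ^ (k - n) = q ^ k := by
    rw [← zpow_natCast, ← zpow_add₀ hq]; congr 1; ring
  linear_combination (zBracket q⁻¹ k * histWeight q n k 0) * (z3 - z1) -
    (zBracket q⁻¹ (n + 1 - k) * histWeight q n (k - 1) 0) * z2

/-- The permutation of `Fin (n + 1)` with last value `v` whose other values are in the same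
relative order as those of `σ`. -/
def snocPerm {n : ℕ} (x : Fin (n + 1) × Equiv.Perm (Fin n)) : Equiv.Perm (Fin (n + 1)) :=
  ((finSuccEquiv' (Fin.last n)).trans (Equiv.optionCongr x.2)).trans (finSuccEquiv' x.1).symm

@[simp] theorem snocPerm_last {n : ℕ} (x : Fin (n + 1) × Equiv.Perm (Fin n)) :
    snocPerm x (Fin.last n) = x.1 := by
  simp [snocPerm]

@[simp] theorem snocPerm_castSucc {n : ℕ} (x : Fin (n + 1) × Equiv.Perm (Fin n)) (i : Fin n) :
    snocPerm x i.castSucc = x.1.succAbove (x.2 i) := by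
  simp [snocPerm, ← Fin.succAbove_last]

theorem snocPerm_bijective (n : ℕ) : Function.Bijective (snocPerm (n := n)) := by
  rw [Fintype.bijective_iff_injective_and_card]
  refine ⟨?_, by simp [Fintype.card_perm, Nat.factorial_succ]⟩
  rintro ⟨v, σ⟩ ⟨w, τ⟩ h
  obtain rfl : v = w := by simpa using DFunLike.congr_fun h (Fin.last n)
  congr 1
  ext1 i
  have := DFunLike.congr_fun h i.castSucc
  simpa using this

theorem descSet_snocPerm {n : ℕ} (v : Fin (n + 2)) (σ : Equiv.Perm (Fin (n + 1))) :
    descSet (snocPerm (v, σ)) = (descSet σ).map Fin.castSuccEmb ∪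
      if (v : ℕ) ≤ σ (Fin.last n) then {(Fin.last n).castSucc} else ∅ := by
  ext i
  refine Fin.lastCases ?_ (fun i => ?_) i
  · have : ∀ j : Fin (n + 1), j.castSucc ≠ Fin.last (n + 1) := fun j => (Fin.castSucc_lt_last j).ne
    split_ifs <;> simp [descSet, this, (this _).symm]
  · refine Fin.lastCases ?_ (fun i => ?_) i
    · have h : (⟨(Fin.last n).castSucc + 1, by simp⟩ : Fin (n + 2)) = Fin.last (n + 1) := by
        ext; simp
      simp only [descSet, mem_union, mem_filter, mem_univ, true_and, mem_map]
      have hlt : v < v.succAbove (σ (Fin.last n)) ↔ (v : ℕ) ≤ σ (Fin.last n) := by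
        rw [Fin.lt_succAbove_iff_le_castSucc, Fin.le_def]; rfl
      have h1 : (∃ h : ((Fin.last n).castSucc : ℕ) + 1 < n + 2,
          (snocPerm (v, σ)) ⟨((Fin.last n).castSucc : ℕ) + 1, h⟩ <
            (snocPerm (v, σ)) (Fin.last n).castSucc) ↔ (v : ℕ) ≤ σ (Fin.last n) := by
        rw [← hlt]
        constructor
        · rintro ⟨_, h2⟩
          rw [h] at h2
          simpa using h2
        · intro h2
          refine ⟨by simp, ?_⟩
          rw [h]
          simpa using h2
      rw [h1]
      split_ifs with h2 <;> simp [h2]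
    · have h : ∀ h : i.castSucc.castSucc.val + 1 < n + 2,
          (⟨i.castSucc.castSucc + 1, h⟩ : Fin (n + 2)) = i.succ.castSucc := fun _ => by
        ext; simp
      have h2 : i.castSucc.castSucc ≠ (Fin.last n).castSucc := by
        simp [(Fin.castSucc_lt_last i).ne]
      have : i.castSucc.castSucc ∉
          (if (v : ℕ) ≤ σ (Fin.last n) then {(Fin.last n).castSucc} else ∅ : Finset _) := by
        split_ifs <;> simp [h2]
      rw [mem_union, or_iff_left this]
      simp only [descSet, mem_filter, mem_univ, true_and, mem_map, h, snocPerm_castSucc]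
      simp [Fin.succAbove_lt_succAbove_iff]
      rfl

theorem desStat_snocPerm {n : ℕ} (v : Fin (n + 2)) (σ : Equiv.Perm (Fin (n + 1))) :
    desStat (snocPerm (v, σ)) = desStat σ + if (v : ℕ) ≤ σ (Fin.last n) then 1 else 0 := by
  have hd : Fin.last n ∉ descSet σ := by simp [descSet]
  unfold desStat
  rw [descSet_snocPerm, card_union_of_disjoint, card_map]
  · split_ifs <;> simp
  · split_ifs <;> simp [hd]

theorem majStat_snocPerm {n : ℕ} (v : Fin (n + 2)) (σ : Equiv.Perm (Fin (n + 1))) :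
    majStat (snocPerm (v, σ)) = majStat σ + if (v : ℕ) ≤ σ (Fin.last n) then n + 1 else 0 := by
  have hd : Fin.last n ∉ descSet σ := by simp [descSet]
  unfold majStat
  rw [descSet_snocPerm, sum_union, sum_map]
  · split_ifs <;> simp
  · split_ifs <;> simp [hd]

/-- The generating function of `majStat` over the permutations of `Fin (n + 1)` with `k` descents
and last value `v`, as given by the recursion on the last value. -/
noncomputable def majLastWeight (q : ℚ) : ℕ → ℤ → ℕ → ℚ
  | 0, k, _ => if k = 0 then 1 else 0
  | n + 1, k, v => ∑ u ∈ Finset.range v, majLastWeight q n k u +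
      q ^ (n + 1) * ∑ u ∈ Finset.Ico v (n + 1), majLastWeight q n (k - 1) u

theorem sum_pow_majStat_of_last (q : ℚ) (n : ℕ) (k : ℤ) (v : Fin (n + 1)) :
    (∑ σ : Equiv.Perm (Fin (n + 1)),
      if (desStat σ : ℤ) = k ∧ σ (Fin.last n) = v then q ^ majStat σ else 0) =
        majLastWeight q n k v := by
  induction n generalizing k with
  | zero =>
    have hd : ∀ σ : Equiv.Perm (Fin (0 + 1)), descSet σ = ∅ := fun σ =>
      Finset.filter_eq_empty_iff.2 fun i _ h => by
        obtain ⟨h, _⟩ := h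
        omega
    have hv : ∀ w : Fin (0 + 1), w = v := fun w => by ext; omega
    simp [desStat, majStat, hd, majLastWeight, hv, eq_comm]
  | succ n ih =>
    have ih' : ∀ k, ∀ s : Finset ℕ, (∀ u ∈ s, u < n + 1) →
        ∑ u ∈ s, majLastWeight q n k u = ∑ σ : Equiv.Perm (Fin (n + 1)),
          if (desStat σ : ℤ) = k ∧ (σ (Fin.last n) : ℕ) ∈ s then q ^ majStat σ else 0 := by
      intro k s hs
      have key : ∀ u ∈ s, majLastWeight q n k u = ∑ σ : Equiv.Perm (Fin (n + 1)),
          if (desStat σ : ℤ) = k ∧ (σ (Fin.last n) : ℕ) = u then q ^ majStat σ else 0 := by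
        intro u hu
        rw [← ih k ⟨u, hs u hu⟩]
        simp only [Fin.ext_iff]
      rw [Finset.sum_congr rfl key, Finset.sum_comm]
      refine Finset.sum_congr rfl fun σ _ => ?_
      by_cases h : (desStat σ : ℤ) = k
      · simp [h]
      · simp [h]
    rw [majLastWeight, ih' _ _ fun u hu => (mem_range.1 hu).trans_le (by omega),
      ih' _ _ fun u hu => (mem_Ico.1 hu).2, mul_sum, ← sum_add_distrib,
      ← (Equiv.ofBijective _ (snocPerm_bijective (n + 1))).sum_comp, Fintype.sum_prod_type,
      Finset.sum_eq_single v]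
    · refine Finset.sum_congr rfl fun σ _ => ?_
      have hlt := (σ (Fin.last n)).isLt
      simp only [Equiv.ofBijective_apply, desStat_snocPerm, majStat_snocPerm, snocPerm_last,
        and_true, mem_range, mem_Ico]
      by_cases h : (v : ℕ) ≤ σ (Fin.last n)
      · have h' : ((desStat σ : ℤ) + 1 = k) ↔ (desStat σ : ℤ) = k - 1 := by omega
        simp [h, not_lt.2 h, h', hlt, -Fin.is_le', pow_add, mul_comm]
      · simp [h, not_le.1 h]
    · intro w _ hw
      simp [hw]
    · simp

theorem majLastWeight_succ_zero (q : ℚ) (n : ℕ) (k : ℤ) :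
    majLastWeight q (n + 1) k 0 =
      q ^ (n + 1) * ∑ u ∈ Finset.range (n + 1), majLastWeight q n (k - 1) u := by
  simp [majLastWeight, Nat.Ico_zero_eq_range]

theorem majLastWeight_succ_succ (q : ℚ) (n : ℕ) (k : ℤ) (v : ℕ) (hv : v ≤ n) :
    majLastWeight q (n + 1) k (v + 1) = majLastWeight q (n + 1) k v + majLastWeight q n k v -
      q ^ (n + 1) * majLastWeight q n (k - 1) v := by
  rw [majLastWeight, majLastWeight, Finset.sum_range_succ,
    Finset.sum_eq_sum_Ico_succ_bot (show v < n + 1 by omega)]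
  ring

theorem majLastWeight_sum_succ_of {q : ℚ} (hq : q ≠ 0) (n : ℕ)
    (h : ∀ (k : ℤ) (v : ℕ), v ≤ n → majLastWeight q (n + 1) k (v + 1) =
      zBracket q (k + 1) * majLastWeight q n k v +
        q ^ k * zBracket q (n + 1 - k) * majLastWeight q n (k - 1) v) (k : ℤ) :
    ∑ u ∈ Finset.range (n + 2), majLastWeight q (n + 1) k u =
      zBracket q (k + 1) * ∑ u ∈ Finset.range (n + 1), majLastWeight q n k u +
        q ^ k * zBracket q (n + 2 - k) *
          ∑ u ∈ Finset.range (n + 1), majLastWeight q n (k - 1) u := by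
  rw [Finset.sum_range_succ', majLastWeight_succ_zero,
    Finset.sum_congr rfl fun u hu => h k u (by simpa [Nat.lt_succ_iff] using hu),
    Finset.sum_add_distrib, ← mul_sum, ← mul_sum]
  have hb : zBracket q ((n : ℤ) + 2 - k) = zBracket q (n + 1 - k) + q ^ ((n : ℤ) + 1 - k) := by
    rw [show (n : ℤ) + 2 - k = (n + 1 - k) + 1 by ring, zBracket_add hq, zBracket_one, mul_one]
  have : q ^ k * q ^ ((n : ℤ) + 1 - k) = q ^ (n + 1) := by
    rw [← zpow_add₀ hq, ← zpow_natCast]; congr 1; push_cast; ring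
  rw [hb, ← this]
  ring

theorem majLastWeight_succ_succ_eq {q : ℚ} (hq : q ≠ 0) (n : ℕ) (k : ℤ) (v : ℕ) (hv : v ≤ n) :
    majLastWeight q (n + 1) k (v + 1) = zBracket q (k + 1) * majLastWeight q n k v +
      q ^ k * zBracket q (n + 1 - k) * majLastWeight q n (k - 1) v := by
  induction n generalizing k v with
  | zero =>
    obtain rfl : v = 0 := by omega
    simp only [majLastWeight]
    by_cases h : k = 0
    · simp [h]
    · by_cases h1 : k = 1
      · simp [h1]
      · simp [h, show k - 1 ≠ 0 by omega]
  | succ n ih =>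
    have hk : q ^ k = q ^ (k - 1) * q := by rw [← zpow_add_one₀ hq, sub_add_cancel]
    have hn : q ^ k * q ^ ((n : ℤ) + 1 - k) = q ^ (n + 1) := by
      rw [← zpow_add₀ hq, ← zpow_natCast]; congr 1; push_cast; ring
    have hk1 := zBracket_add hq k 1
    have hk2 := zBracket_add hq 1 k
    rw [add_comm 1 k] at hk2
    have hn1 := zBracket_add hq ((n : ℤ) + 1 - k) 1
    have hn2 := zBracket_add hq 1 ((n : ℤ) + 1 - k)
    simp only [zBracket_one, zpow_one, mul_one] at hk1 hk2 hn1 hn2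
    have e1 : (n : ℤ) + 1 - (k - 1) = n + 1 - k + 1 := by ring
    have e2 : ((n + 1 : ℕ) : ℤ) + 1 - k = n + 1 - k + 1 := by push_cast; ring
    have e3 : (n : ℤ) + 2 - (k - 1) = n + 1 - k + 1 + 1 := by ring
    induction v with
    | zero =>
      have ht := majLastWeight_sum_succ_of hq n ih (k - 1)
      rw [majLastWeight_succ_succ q (n + 1) k 0 (by omega)]
      simp only [majLastWeight_succ_zero] at ht ⊢
      rw [sub_add_cancel, e3] at ht
      rw [ht, e2]
      have hn3 := zBracket_add hq ((n : ℤ) + 1 - k + 1) 1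
      rw [zBracket_one, mul_one, zpow_add_one₀ hq] at hn3
      have e4 : k - 1 - 1 + 1 = k - 1 := by ring
      linear_combination
        (-q ^ (n + 1) * ∑ u ∈ Finset.range (n + 1), majLastWeight q n (k - 1) u) * hk2 +
        (q ^ (n + 1) * ∑ u ∈ Finset.range (n + 1), majLastWeight q n (k - 1 - 1) u) *
          (-zBracket q (n + 1 - k + 1 + 1) * hk + q ^ k * hn3 + q * hn)
    | succ v ihv =>
      have i0 := ih k v (by omega)
      have i1 := ih (k - 1) v (by omega)
      have j0 := majLastWeight_succ_succ q n k v (by omega)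
      have j1 := majLastWeight_succ_succ q n (k - 1) v (by omega)
      rw [majLastWeight_succ_succ q (n + 1) k (v + 1) (by omega), ihv (by omega)]
      rw [e1, sub_add_cancel] at i1
      rw [e2]
      linear_combination -zBracket q (k + 1) * j0 -
        q ^ k * zBracket q (n + 1 - k + 1) * j1 + i0 - q ^ (n + 2) * i1 +
        majLastWeight q n (k - 1) v * q ^ (n + 1) * hk2 -
        q ^ k * majLastWeight q n (k - 1) v * hn1 - majLastWeight q n (k - 1) v * hn +
        q ^ (n + 1) * zBracket q (n + 1 - k + 1) * majLastWeight q n (k - 1 - 1) v * hk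

theorem sum_majLastWeight_eq {q : ℚ} (hq : q ≠ 0) (n : ℕ) (k : ℤ) :
    ∑ u ∈ Finset.range (n + 1), majLastWeight q n k u = histWeight q (n + 1) k 0 := by
  induction n generalizing k with
  | zero =>
    rw [histWeight_succ_zero hq]
    simp only [majLastWeight, histWeight]
    by_cases h : k = 0
    · simp [h]
    · by_cases h1 : k = 1
      · simp [h1]
      · simp [h, show k - 1 ≠ 0 by omega]
  | succ n ih =>
    rw [majLastWeight_sum_succ_of hq n (fun k v hv => majLastWeight_succ_succ_eq hq n k v hv),
      histWeight_succ_zero hq (n + 1), ih, ih]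
    congr 4

theorem sum_pow_majStat {q : ℚ} (hq : q ≠ 0) (n k : ℕ) :
    ∑ σ ∈ Finset.univ.filter (fun σ : Equiv.Perm (Fin n) => desStat σ = k),
      q ^ (majStat σ : ℤ) = histWeight q n k 0 := by
  cases n with
  | zero =>
    have hd : ∀ σ : Equiv.Perm (Fin 0), descSet σ = ∅ := fun σ => by
      ext i; exact i.elim0
    by_cases h : k = 0 <;> simp [desStat, majStat, hd, histWeight, h, eq_comm]
  | succ n =>
    rw [← sum_majLastWeight_eq hq, Finset.sum_filter, Finset.sum_range,
      Finset.sum_congr rfl fun v _ => (sum_pow_majStat_of_last q n k v).symm, Finset.sum_comm]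
    refine Finset.sum_congr rfl fun σ _ => ?_
    by_cases h : desStat σ = k <;> simp [h]

/-- The arcs that cross the arc closing at the value `v` from the inside. -/
def valDefect {n : ℕ} (σ : Equiv.Perm (Fin n)) (v : Fin n) : ℕ :=
  #{r | σ.symm v < r ∧ r < v ∧ v < σ r}

/-- The values below `σ m` that are taken to the right of the position `m`. -/
def posDefect {n : ℕ} (σ : Equiv.Perm (Fin n)) (m : Fin n) : ℕ :=
  #{w | m < σ.symm w ∧ w < σ m}

/-- The code letter of the value `v`: its weight if `v` is an excedance value, else `none`. -/
def valStep {n : ℕ} (σ : Equiv.Perm (Fin n)) (v : Fin n) : Option ℤ :=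
  if σ.symm v < v then some ((v : ℕ) - valDefect σ v) else none

/-- The code letter of the position `m`: `none` if `m` is an excedance, else its weight. -/
def posStep {n : ℕ} (σ : Equiv.Perm (Fin n)) (m : Fin n) : Option ℤ :=
  if m < σ m then none else some (0 - posDefect σ m)

theorem card_filter_lt_apply {n : ℕ} (σ : Equiv.Perm (Fin n)) (j : Fin n) :
    #{i | σ i < j} = (j : ℕ) := by
  rw [← Fin.card_Iio j]
  exact Finset.card_equiv σ (by simp)

theorem posDefect_eq {n : ℕ} (σ : Equiv.Perm (Fin n)) (m : Fin n) :
    posDefect σ m = #{i | m < i ∧ σ i < σ m} :=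
  (Finset.card_equiv σ (by simp)).symm

theorem card_filter_prod {n : ℕ} (P : Fin n → Fin n → Prop) [∀ i j, Decidable (P i j)] :
    #{p : Fin n × Fin n | P p.1 p.2} = ∑ j, #{i | P i j} := by
  simp only [Finset.card_filter]
  rw [Fintype.sum_prod_type_right]

theorem sum_getD_valStep {n : ℕ} (σ : Equiv.Perm (Fin n)) :
    ∑ v, (valStep σ v).getD 0 =
      ∑ j, ((if j < σ j then ((σ j : ℕ) : ℤ) else 0) - #{i | i < j ∧ j < σ i ∧ σ i < σ j}) := by
  rw [← Equiv.sum_comp σ, sum_sub_distrib, ← Nat.cast_sum, ← card_filter_prod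
    (fun i j => i < j ∧ j < σ i ∧ σ i < σ j)]
  have : #{p : Fin n × Fin n | p.1 < p.2 ∧ p.2 < σ p.1 ∧ σ p.1 < σ p.2} =
      ∑ i, #{r | i < r ∧ r < σ i ∧ σ i < σ r} := by
    simp only [Finset.card_filter]
    rw [Fintype.sum_prod_type]
  rw [this, Nat.cast_sum, ← sum_sub_distrib]
  refine Finset.sum_congr rfl fun i _ => ?_
  by_cases h : i < σ i
  · simp [valStep, valDefect, h]
  · have : ∀ r, ¬(i < r ∧ r < σ i ∧ σ i < σ r) := fun r hr => h (hr.1.trans hr.2.1)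
    simp [valStep, h, this]

theorem statA_eq_sum {n : ℕ} (σ : Equiv.Perm (Fin n)) :
    statA σ = ∑ v, ((posStep σ v).getD 0 + (valStep σ v).getD 0) := by
  rw [sum_add_distrib, sum_getD_valStep, statA, sum_filter, sum_filter,
    card_filter_prod (fun i j => i < j ∧ σ j < σ i ∧ j < σ j),
    card_filter_prod (fun i j => i < j ∧ (σ i : ℕ) ≤ j ∧ σ i < σ j),
    Nat.cast_sum, Nat.cast_sum, ← sum_add_distrib, ← sum_add_distrib, ← sum_add_distrib,
    ← sum_add_distrib]
  refine Finset.sum_congr rfl fun j _ => ?_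
  have hinj : ∀ i, σ i = σ j → i = j := fun i h => σ.injective h
  by_cases h : j < σ j
  · have hj : (j : ℕ) = #{i | i < j ∧ σ j < σ i ∧ j < σ j} +
        #{i | i < j ∧ (σ i : ℕ) ≤ j ∧ σ i < σ j} + #{i | i < j ∧ j < σ i ∧ σ i < σ j} := by
      have hc : #{i | i < j} = (j : ℕ) := card_filter_lt_apply 1 j
      refine hc.symm.trans ?_
      simp only [Finset.card_filter, ← sum_add_distrib]
      refine Finset.sum_congr rfl fun i _ => ?_
      have := hinj i
      simp only [Fin.lt_def, Fin.ext_iff] at *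
      split_ifs <;> omega
    simp only [posStep, h, if_true, not_le.2 h, if_false, Option.getD_none]
    simp only [h] at hj
    omega
  · have h1 : #{i | i < j ∧ σ j < σ i ∧ j < σ j} = 0 := by simp [h]
    have h2 : #{i | i < j ∧ j < σ i ∧ σ i < σ j} = 0 := by
      rw [Finset.card_eq_zero, Finset.filter_eq_empty_iff]
      exact fun i _ hi => h (hi.2.1.trans hi.2.2)
    have hj : (σ j : ℕ) = #{i | i < j ∧ (σ i : ℕ) ≤ j ∧ σ i < σ j} + posDefect σ j := by
      rw [posDefect_eq, ← card_filter_lt_apply σ]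
      simp only [Finset.card_filter, ← sum_add_distrib]
      refine Finset.sum_congr rfl fun i _ => ?_
      have := hinj i
      simp only [Fin.lt_def, Fin.ext_iff] at *
      split_ifs <;> try omega
      all_goals
        obtain hij : i = j := Fin.ext (by omega)
        subst hij
        omega
    rw [h1, h2]
    simp only [posStep, h, not_lt.1 h, if_true, if_false, Option.getD_some]
    omega

/-- The weight of a code word: the sum of its letters, `none` counting as `0`. -/
def codeWeight (l : List (Option ℤ)) : ℤ := (l.map fun x => x.getD 0).sum

/-- The words obtained from those of `S` by adding the letter `none` and from those of `T` by
adding one of the letters `c, c - 1, …, c - h + 1`. -/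
def extendCodes (c h : ℤ) (S T : Finset (List (Option ℤ))) : Finset (List (Option ℤ)) :=
  S.image (fun l => none :: l) ∪
    (Finset.range h.toNat ×ˢ T).image fun p => some (c - (p.1 : ℤ)) :: p.2

/-- The code words of length `2 * n` with `b` closed and `d` open arcs. -/
def codes : ℕ → ℤ → ℤ → Finset (List (Option ℤ))
  | 0, b, d => if b = 0 ∧ d = 0 then {[]} else ∅
  | n + 1, b, d => extendCodes 0 (d + 1)
      (extendCodes n d (codes n b (d - 1)) (codes n (b - 1) d))
      (extendCodes n (d + 1) (codes n b d) (codes n (b - 1) (d + 1)))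

theorem none_cons_mem_extendCodes {c h : ℤ} {S T : Finset (List (Option ℤ))}
    {l : List (Option ℤ)} (hl : l ∈ S) : none :: l ∈ extendCodes c h S T :=
  mem_union_left _ (mem_image_of_mem _ hl)

theorem some_cons_mem_extendCodes {c h : ℤ} {S T : Finset (List (Option ℤ))}
    {l : List (Option ℤ)} {x : ℕ} (hx : (x : ℤ) < h) (hl : l ∈ T) :
    some (c - (x : ℤ)) :: l ∈ extendCodes c h S T := by
  refine mem_union_right _ (mem_image.2 ⟨(x, l), ?_, rfl⟩)
  rw [mem_product, mem_range]
  exact ⟨by omega, hl⟩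

theorem sum_extendCodes {q : ℚ} (hq : q ≠ 0) {c h : ℤ} {S T : Finset (List (Option ℤ))}
    (hh : 0 ≤ h ∨ ∑ l ∈ T, q ^ codeWeight l = 0) :
    ∑ l ∈ extendCodes c h S T, q ^ codeWeight l =
      ∑ l ∈ S, q ^ codeWeight l + q ^ c * zBracket q⁻¹ h * ∑ l ∈ T, q ^ codeWeight l := by
  have hsum : (∑ i ∈ Finset.range h.toNat, q⁻¹ ^ i) * ∑ l ∈ T, q ^ codeWeight l =
      zBracket q⁻¹ h * ∑ l ∈ T, q ^ codeWeight l := by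
    rcases hh with hh | hh
    · obtain ⟨m, rfl⟩ := Int.eq_ofNat_of_zero_le hh
      rw [zBracket_natCast (inv_ne_zero hq)]
      rfl
    · simp [hh]
  rw [extendCodes, sum_union, sum_image, sum_image, mul_assoc, ← hsum, sum_mul_sum, sum_product,
    mul_sum]
  · congr 1
    · simp [codeWeight]
    · refine sum_congr rfl fun i _ => ?_
      rw [mul_sum]
      refine sum_congr rfl fun l _ => ?_
      simp [codeWeight, zpow_add₀ hq, zpow_sub₀ hq, div_eq_mul_inv, mul_assoc]
  · rintro ⟨i, l⟩ _ ⟨j, l'⟩ _ h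
    simpa using h
  · intro l _ l' _ h
    simpa using h
  · rw [disjoint_left]
    intro l h1 h2
    obtain ⟨_, _, rfl⟩ := mem_image.1 h1
    obtain ⟨_, _, h⟩ := mem_image.1 h2
    simp at h

theorem sum_codes {q : ℚ} (hq : q ≠ 0) (n : ℕ) (b d : ℤ) :
    ∑ l ∈ codes n b d, q ^ codeWeight l = histWeight q n b d := by
  induction n generalizing b d with
  | zero =>
    by_cases h : b = 0 ∧ d = 0 <;> simp [codes, histWeight, h, codeWeight]
  | succ n ih =>
    have hv : ∀ b d, ∑ l ∈ extendCodes n d (codes n b (d - 1)) (codes n (b - 1) d),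
        q ^ codeWeight l =
          histWeight q n b (d - 1) + q ^ n * zBracket q⁻¹ d * histWeight q n (b - 1) d := by
      intro b d
      rw [sum_extendCodes hq, ih, ih, zpow_natCast]
      rw [ih]
      by_cases h : 0 ≤ d
      · exact Or.inl h
      · exact Or.inr (histWeight_eq_zero_of_neg q n _ _ (by omega))
    have hv' := hv b (d + 1)
    rw [add_sub_cancel_right] at hv'
    rw [codes, sum_extendCodes hq, hv, hv', histWeight, zpow_zero, one_mul]
    rw [hv']
    by_cases h : 0 ≤ d + 1
    · exact Or.inl h
    · refine Or.inr ?_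
      rw [histWeight_eq_zero_of_neg q n b d (by omega),
        histWeight_eq_zero_of_neg q n (b - 1) (d + 1) (by omega)]
      ring

theorem card_codes (n : ℕ) (b d : ℤ) : (#(codes n b d) : ℚ) = histWeight 1 n b d := by
  rw [← sum_codes one_ne_zero]
  simp

theorem sum_histWeight_one (n m : ℕ) (h : n < m) :
    ∑ k ∈ Finset.range m, histWeight 1 n k 0 = n.factorial := by
  have h1 : ∀ z, zBracket 1 z = z := by simp [zBracket]
  induction n generalizing m with
  | zero =>
    obtain ⟨m, rfl⟩ : ∃ a, m = a + 1 := ⟨m - 1, by omega⟩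
    simp [histWeight]
  | succ n ih =>
    obtain ⟨m, rfl⟩ : ∃ a, m = a + 1 := ⟨m - 1, by omega⟩
    have hsplit : ∀ k : ℤ, histWeight 1 (n + 1) k 0 =
        (k + 1) * histWeight 1 n k 0 + (n + 1 - k) * histWeight 1 n (k - 1) 0 := by
      intro k
      rw [histWeight_succ_zero one_ne_zero, h1, h1]
      push_cast
      simp
    have h0 : histWeight 1 n (-1) 0 = 0 := histWeight_eq_zero_of_neg 1 n _ _ (by omega)
    have hm : histWeight 1 n m 0 = 0 := histWeight_eq_zero_of_lt 1 n _ _ (by omega)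
    simp only [hsplit]
    rw [sum_add_distrib, Finset.sum_range_succ, hm,
      Finset.sum_range_succ' (fun k : ℕ => ((n : ℚ) + 1 - ((k : ℤ) : ℚ)) * _), Nat.cast_zero,
      zero_sub, h0, mul_zero, mul_zero, add_zero, add_zero, ← sum_add_distrib,
      Nat.factorial_succ, Nat.cast_mul, ← ih m (by omega), mul_sum]
    refine sum_congr rfl fun k _ => ?_
    push_cast
    rw [add_sub_cancel_right]
    ring

/-- The code word recording the first `m` positions and values of `σ`. -/
def permCode {n : ℕ} (σ : Equiv.Perm (Fin n)) : ℕ → List (Option ℤ)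
  | 0 => []
  | m + 1 => if h : m < n then posStep σ ⟨m, h⟩ :: valStep σ ⟨m, h⟩ :: permCode σ m
      else permCode σ m

theorem codeWeight_permCode {n : ℕ} (σ : Equiv.Perm (Fin n)) (m : ℕ) :
    codeWeight (permCode σ m) =
      ∑ v : Fin n, if (v : ℕ) < m then (posStep σ v).getD 0 + (valStep σ v).getD 0 else 0 := by
  induction m with
  | zero => simp [permCode, codeWeight]
  | succ m ih =>
    rw [permCode]
    split_ifs with h
    · have hs : ∀ v : Fin n, (if (v : ℕ) < m + 1 then
          (posStep σ v).getD 0 + (valStep σ v).getD 0 else 0) =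
          (if v = ⟨m, h⟩ then (posStep σ v).getD 0 + (valStep σ v).getD 0 else 0) +
          if (v : ℕ) < m then (posStep σ v).getD 0 + (valStep σ v).getD 0 else 0 := by
        intro v
        simp only [Fin.ext_iff]
        split_ifs <;> omega
      rw [sum_congr rfl fun v _ => hs v, sum_add_distrib, ← ih, sum_ite_eq' univ]
      simp [codeWeight, add_assoc]
    · rw [ih]
      refine sum_congr rfl fun v _ => ?_
      have := v.isLt
      rw [if_pos (by omega), if_pos (by omega)]

theorem codeWeight_permCode_self {n : ℕ} (σ : Equiv.Perm (Fin n)) :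
    codeWeight (permCode σ n) = statA σ := by
  simp [codeWeight_permCode, statA_eq_sum]

/-- The number of excedance values of `σ` below `m`. -/
def closedArcs {n : ℕ} (σ : Equiv.Perm (Fin n)) (m : ℕ) : ℕ :=
  #{v : Fin n | (v : ℕ) < m ∧ σ.symm v < v}

/-- The number of positions below `m` whose value is at least `m`. -/
def openArcs {n : ℕ} (σ : Equiv.Perm (Fin n)) (m : ℕ) : ℕ :=
  #{p : Fin n | (p : ℕ) < m ∧ m ≤ (σ p : ℕ)}

theorem closedArcs_succ {n : ℕ} (σ : Equiv.Perm (Fin n)) (m : Fin n) :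
    closedArcs σ (m + 1) = closedArcs σ m + if σ.symm m < m then 1 else 0 := by
  simp only [closedArcs, Finset.card_filter]
  have : (if σ.symm m < m then 1 else 0) =
      ∑ v, if v = m then (if σ.symm v < v then 1 else 0) else 0 := by simp
  rw [this, ← sum_add_distrib]
  refine sum_congr rfl fun v _ => ?_
  simp only [Fin.ext_iff]
  split_ifs <;> omega

theorem openArcs_eq {n : ℕ} (σ : Equiv.Perm (Fin n)) (m : Fin n) :
    openArcs σ m = #{p | p < m ∧ m < σ p} + if σ.symm m < m then 1 else 0 := by
  simp only [openArcs, Finset.card_filter]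
  have : (if σ.symm m < m then 1 else 0) =
      ∑ p, if p = σ.symm m then (if p < m then 1 else 0) else 0 := by simp
  rw [this, ← sum_add_distrib]
  refine sum_congr rfl fun p _ => ?_
  simp only [Equiv.eq_symm_apply, Fin.ext_iff, Fin.lt_def]
  split_ifs <;> omega

theorem openArcs_succ {n : ℕ} (σ : Equiv.Perm (Fin n)) (m : Fin n) :
    openArcs σ (m + 1) = #{p | p < m ∧ m < σ p} + if m < σ m then 1 else 0 := by
  simp only [openArcs, Finset.card_filter]
  have : (if m < σ m then 1 else 0) =
      ∑ p, if p = m then (if m < σ p then 1 else 0) else 0 := by simp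
  rw [this, ← sum_add_distrib]
  refine sum_congr rfl fun p _ => ?_
  simp only [Fin.ext_iff, Fin.lt_def]
  split_ifs <;> omega

theorem valDefect_le {n : ℕ} (σ : Equiv.Perm (Fin n)) (m : Fin n) :
    valDefect σ m ≤ #{p | p < m ∧ m < σ p} :=
  card_le_card fun r hr => by
    simp only [mem_filter, mem_univ, true_and] at hr ⊢
    exact hr.2

theorem posDefect_le {n : ℕ} (σ : Equiv.Perm (Fin n)) (m : Fin n) (hm : σ m ≤ m) :
    posDefect σ m ≤ #{p | p < m ∧ m < σ p} := by
  have h1 : #{p | p ≤ m} = #{p | σ p ≤ m} := (Finset.card_equiv σ (by simp)).symm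
  have h2 : #{p | p ≤ m} = #{p | p ≤ m ∧ σ p ≤ m} + #{p | p < m ∧ m < σ p} := by
    simp only [Finset.card_filter, ← sum_add_distrib]
    refine sum_congr rfl fun p _ => ?_
    by_cases hp : p = m
    · subst hp; simp [hm]
    · simp only [Fin.ext_iff, Fin.lt_def, Fin.le_def] at *
      split_ifs <;> omega
  have h3 : #{p | p ≤ m ∧ σ p ≤ m} + #{i | m < i ∧ σ i < σ m} ≤ #{p | σ p ≤ m} := by
    simp only [Finset.card_filter, ← sum_add_distrib]
    refine sum_le_sum fun p _ => ?_
    simp only [Fin.lt_def, Fin.le_def] at *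
    split_ifs <;> omega
  rw [posDefect_eq]
  omega

theorem permCode_mem_codes {n : ℕ} (σ : Equiv.Perm (Fin n)) (m : ℕ) (hm : m ≤ n) :
    permCode σ m ∈ codes m (closedArcs σ m) (openArcs σ m) := by
  induction m with
  | zero => simp [permCode, codes, closedArcs, openArcs]
  | succ m ih =>
    have ih := ih (by omega)
    obtain ⟨v, rfl⟩ : ∃ v : Fin n, m = v := ⟨⟨m, hm⟩, rfl⟩
    rw [permCode, dif_pos v.isLt, codes]
    simp only [Fin.eta]
    rw [openArcs_eq] at ih
    rw [closedArcs_succ, openArcs_succ]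
    set H := #{p | p < v ∧ v < σ p} with hH
    have hval : valStep σ v :: permCode σ v ∈ extendCodes v ((H : ℤ) + 1)
        (codes v (closedArcs σ v + if σ.symm v < v then 1 else 0 : ℕ) H)
        (codes v ((closedArcs σ v + if σ.symm v < v then 1 else 0 : ℕ) - 1) ((H : ℤ) + 1)) := by
      by_cases h : σ.symm v < v
      · simp only [valStep, h, if_true] at ih ⊢
        refine some_cons_mem_extendCodes ?_ ?_
        · have := valDefect_le σ v
          omega
        · push_cast at ih ⊢
          rwa [add_sub_cancel_right]
      · simp only [valStep, h, if_false] at ih ⊢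
        exact none_cons_mem_extendCodes ih
    by_cases h : v < σ v
    · simp only [posStep, h, if_true]
      refine none_cons_mem_extendCodes ?_
      push_cast at hval ⊢
      rwa [add_sub_cancel_right]
    · simp only [posStep, h, if_false, add_zero]
      refine some_cons_mem_extendCodes ?_ hval
      have := posDefect_le σ v (not_lt.1 h)
      omega

theorem permCode_self_mem_codes {n : ℕ} (σ : Equiv.Perm (Fin n)) :
    permCode σ n ∈ codes n (excStat σ) 0 := by
  have h := permCode_mem_codes σ n le_rfl
  have h1 : closedArcs σ n = excStat σ := by
    rw [closedArcs, excStat]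
    exact (Finset.card_equiv σ (by simp)).symm
  have h2 : openArcs σ n = 0 := by
    rw [openArcs, card_eq_zero, filter_eq_empty_iff]
    intro p _ hp
    have := (σ p).isLt
    omega
  rwa [h1, h2] at h

theorem steps_eq_of_permCode_eq {n : ℕ} {σ τ : Equiv.Perm (Fin n)} (m : ℕ) (hm : m ≤ n)
    (h : permCode σ m = permCode τ m) (v : Fin n) (hv : (v : ℕ) < m) :
    posStep σ v = posStep τ v ∧ valStep σ v = valStep τ v := by
  induction m with
  | zero => omega
  | succ m ih =>
    have hm' : m < n := hm
    rw [permCode, permCode, dif_pos hm', dif_pos hm', List.cons.injEq, List.cons.injEq] at h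
    by_cases hvm : (v : ℕ) = m
    · obtain rfl : v = ⟨m, hm⟩ := Fin.ext hvm
      exact ⟨h.1, h.2.1⟩
    · exact ih (by omega) h.2.2 (by omega)

theorem symm_apply_le_of_valDefect_eq {n : ℕ} {σ τ : Equiv.Perm (Fin n)} {m : Fin n}
    (hop : ∀ r < m, m ≤ τ r → m ≤ σ r) (hτ : τ.symm m < m)
    (h : valDefect σ m = valDefect τ m) : τ.symm m ≤ σ.symm m := by
  by_contra! hlt
  refine h.not_gt (card_lt_card ?_)
  rw [ssubset_iff_of_subset]
  · refine ⟨τ.symm m, ?_, by simp⟩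
    simp only [mem_filter, mem_univ, true_and]
    refine ⟨hlt, hτ, lt_of_le_of_ne (hop _ hτ (by simp)) fun he => ?_⟩
    rw [← σ.symm_apply_eq.2 he] at hlt
    exact lt_irrefl _ hlt
  · intro r hr
    simp only [mem_filter, mem_univ, true_and] at hr ⊢
    refine ⟨hlt.trans hr.1, hr.2.1, lt_of_le_of_ne (hop _ hr.2.1 hr.2.2.le) fun he => ?_⟩
    rw [← σ.symm_apply_eq.2 he] at hr
    exact lt_asymm hlt hr.1

theorem apply_le_of_posDefect_eq {n : ℕ} {σ τ : Equiv.Perm (Fin n)} {m : Fin n}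
    (hop : ∀ w ≤ m, m ≤ σ.symm w → m ≤ τ.symm w) (hτ : τ m ≤ m)
    (h : posDefect σ m = posDefect τ m) : τ m ≤ σ m := by
  by_contra! hlt
  refine h.not_lt (card_lt_card ?_)
  rw [ssubset_iff_of_subset]
  · refine ⟨σ m, ?_, by simp⟩
    simp only [mem_filter, mem_univ, true_and]
    refine ⟨lt_of_le_of_ne (hop _ (hlt.le.trans hτ) (by simp)) fun he => ?_, hlt⟩
    rw [← τ.eq_symm_apply.1 he] at hlt
    exact lt_irrefl _ hlt
  · intro w hw
    simp only [mem_filter, mem_univ, true_and] at hw ⊢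
    refine ⟨lt_of_le_of_ne (hop _ ((hw.2.trans hlt).le.trans hτ) hw.1.le) fun he => ?_,
      hw.2.trans hlt⟩
    rw [← τ.eq_symm_apply.1 he] at hw
    exact lt_asymm hlt hw.2

theorem valStep_eq_iff {n : ℕ} {σ τ : Equiv.Perm (Fin n)} {v : Fin n} :
    valStep σ v = valStep τ v ↔
      (σ.symm v < v ↔ τ.symm v < v) ∧ (σ.symm v < v → valDefect σ v = valDefect τ v) := by
  unfold valStep
  split_ifs <;> simp [*]

theorem posStep_eq_iff {n : ℕ} {σ τ : Equiv.Perm (Fin n)} {m : Fin n} :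
    posStep σ m = posStep τ m ↔
      (σ m ≤ m ↔ τ m ≤ m) ∧ (σ m ≤ m → posDefect σ m = posDefect τ m) := by
  unfold posStep
  simp only [← not_lt]
  split_ifs <;> simp [*]

theorem permCode_injective (n : ℕ) :
    Function.Injective fun σ : Equiv.Perm (Fin n) => permCode σ n := by
  intro σ τ h
  have hs := fun v : Fin n => steps_eq_of_permCode_eq n le_rfl h v v.isLt
  have key : ∀ m ≤ n, ∀ p v : Fin n, (p : ℕ) < m → (v : ℕ) < m → (σ p = v ↔ τ p = v) := by
    intro m hm
    induction m with
    | zero => intro p v hp; omega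
    | succ m ih =>
      have ih := ih (by omega)
      obtain ⟨m, rfl⟩ : ∃ v : Fin n, m = v := ⟨⟨m, hm⟩, rfl⟩
      obtain ⟨hpos, hval⟩ := hs m
      rw [posStep_eq_iff] at hpos
      rw [valStep_eq_iff] at hval
      have hop : ∀ r < m, m ≤ τ r ↔ m ≤ σ r := by
        intro r hr
        constructor <;> intro hle <;> by_contra! hlt
        · exact absurd ((ih r _ hr hlt).1 rfl ▸ hle) hlt.not_ge
        · exact absurd ((ih r _ hr hlt).2 rfl ▸ hle) hlt.not_ge
      have hv : ∀ p < m, σ p = m ↔ τ p = m := by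
        have : σ.symm m < m → σ.symm m = τ.symm m := fun hlt =>
          le_antisymm
            (symm_apply_le_of_valDefect_eq (fun r hr => (hop r hr).2) hlt (hval.2 hlt).symm)
            (symm_apply_le_of_valDefect_eq (fun r hr => (hop r hr).1) (hval.1.1 hlt) (hval.2 hlt))
        intro p hp
        rw [← Equiv.eq_symm_apply, ← Equiv.eq_symm_apply]
        constructor
        · rintro rfl; exact this hp
        · rintro rfl; exact (this (hval.1.2 hp)).symm
      have hop' : ∀ w ≤ m, m ≤ σ.symm w ↔ m ≤ τ.symm w := by
        have : ∀ p < m, ∀ w ≤ m, σ p = w ↔ τ p = w := by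
          intro p hp w hw
          rcases hw.eq_or_lt with rfl | hw
          · exact hv p hp
          · exact ih p w hp hw
        intro w hw
        constructor <;> intro hle <;> by_contra! hlt
        · have := (this _ hlt w hw).2 (by simp)
          rw [← this, Equiv.symm_apply_apply] at hle
          exact hle.not_gt hlt
        · have := (this _ hlt w hw).1 (by simp)
          rw [← this, Equiv.symm_apply_apply] at hle
          exact hle.not_gt hlt
      have hp : ∀ v ≤ m, σ m = v ↔ τ m = v := by
        have : σ m ≤ m → σ m = τ m := fun hle =>
          le_antisymm
            (apply_le_of_posDefect_eq (fun w hw => (hop' w hw).2) hle (hpos.2 hle).symm)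
            (apply_le_of_posDefect_eq (fun w hw => (hop' w hw).1) (hpos.1.1 hle) (hpos.2 hle))
        intro v hvm
        constructor
        · rintro rfl; exact (this hvm).symm
        · rintro rfl; exact this (hpos.1.2 hvm)
      intro p v hpm hvm
      rcases (Nat.lt_succ_iff.1 hvm).eq_or_lt with hvm | hvm
      · obtain rfl : v = m := Fin.ext hvm
        rcases (Nat.lt_succ_iff.1 hpm).eq_or_lt with hpm | hpm
        · obtain rfl : p = v := Fin.ext hpm
          exact hp _ le_rfl
        · exact hv p hpm
      · rcases (Nat.lt_succ_iff.1 hpm).eq_or_lt with hpm | hpm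
        · obtain rfl : p = m := Fin.ext hpm
          exact hp v (le_of_lt hvm)
        · exact ih p v hpm hvm
  ext1 p
  exact ((key n le_rfl p (σ p) p.isLt (σ p).isLt).1 rfl).symm

theorem image_permCode {n : ℕ} (k : ℕ) :
    ({σ : Equiv.Perm (Fin n) | excStat σ = k} : Finset _).image (fun σ => permCode σ n) =
      codes n k 0 := by
  have hsub : ∀ k : ℕ, ({σ : Equiv.Perm (Fin n) | excStat σ = k} : Finset _).image
      (fun σ => permCode σ n) ⊆ codes n k 0 := by
    intro k l hl
    obtain ⟨σ, hσ, rfl⟩ := mem_image.1 hl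
    rw [← (mem_filter.1 hσ).2]
    exact permCode_self_mem_codes σ
  have hle : ∀ k : ℕ, #{σ : Equiv.Perm (Fin n) | excStat σ = k} ≤ #(codes n k 0) := fun k => by
    rw [← card_image_of_injective _ (permCode_injective n)]
    exact card_le_card (hsub k)
  have hexc : ∀ σ : Equiv.Perm (Fin n), excStat σ < n + 1 := fun σ =>
    Nat.lt_succ_of_le ((card_le_univ _).trans_eq (Fintype.card_fin n))
  have hsum : ∑ i ∈ Finset.range (n + 1 + k), #{σ : Equiv.Perm (Fin n) | excStat σ = i} =
      ∑ i ∈ Finset.range (n + 1 + k), #(codes n i 0) := by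
    rw [← card_eq_sum_card_fiberwise (f := excStat) (s := univ), card_univ, Fintype.card_perm,
      Fintype.card_fin]
    · have := sum_histWeight_one n (n + 1 + k) (by omega)
      simp only [← card_codes] at this
      exact_mod_cast this.symm
    · intro σ _
      have := hexc σ
      simp only [coe_range, Set.mem_Iio]
      omega
  refine eq_of_subset_of_card_le (hsub k) ?_
  rw [card_image_of_injective _ (permCode_injective n)]
  exact ((sum_eq_sum_iff_of_le fun i _ => hle i).1 hsum k (mem_range.2 (by omega))).ge

theorem sum_pow_statA {q : ℚ} (hq : q ≠ 0) (n k : ℕ) :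
    ∑ σ ∈ Finset.univ.filter (fun σ : Equiv.Perm (Fin n) => excStat σ = k), q ^ statA σ =
      histWeight q n k 0 := by
  rw [← sum_codes hq, ← image_permCode, sum_image (permCode_injective n).injOn]
  simp only [codeWeight_permCode_self]

theorem statement14 (q : ℚ) (hq : q ≠ 0) (n k : ℕ) :
    ∑ σ ∈ Finset.univ.filter (fun σ : Equiv.Perm (Fin n) => excStat σ = k),
        q ^ statA σ =
      ∑ σ ∈ Finset.univ.filter (fun σ : Equiv.Perm (Fin n) => desStat σ = k),
        q ^ (majStat σ : ℤ) := by
  exact (sum_pow_statA hq n k).trans (sum_pow_majStat hq n k).symm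
end

section
/- For any admissible Ferrers board B = B(c_1,…,c_n) with 0 ≤ c_1 ≤ ⋯ ≤ c_n ≤ n and any 0 ≤ k ≤ n, the q-hit polynomial T_k(B;q) is either identically zero or is a polynomial with nonnegative integer coefficients that is symmetric and unimodal with darga equal to N_k(B) := Area(B) + n(n-k) - C(n+1,2). -/
open Finset
open scoped Classical

/-- Symmetric integer polynomial. -/
def IsSymmPolyZ (f : Polynomial ℤ) : Prop :=
  ∀ k ≤ f.natDegree - f.natTrailingDegree,
    f.coeff (f.natTrailingDegree + k) = f.coeff (f.natDegree - k)

/-- Unimodal integer polynomial. -/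
def IsUnimodalPolyZ (f : Polynomial ℤ) : Prop :=
  ∃ p : ℕ, (∀ i j, i ≤ j → j ≤ p → f.coeff i ≤ f.coeff j) ∧
    (∀ i j, p ≤ i → i ≤ j → f.coeff j ≤ f.coeff i)

/-- `f` is zero, or has nonnegative coefficients and is symmetric and unimodal
with darga `d`. -/
def ZSUZ (f : Polynomial ℤ) (d : ℤ) : Prop :=
  f = 0 ∨ ((∀ i, 0 ≤ f.coeff i) ∧ IsSymmPolyZ f ∧ IsUnimodalPolyZ f ∧
    ((f.natTrailingDegree : ℤ) + f.natDegree = d))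

/-- The coefficients of an integer polynomial, extended by zero to negative indices. -/
def zcoeff (f : Polynomial ℤ) (i : ℤ) : ℤ := if 0 ≤ i then f.coeff i.toNat else 0

lemma zcoeff_natCast (f : Polynomial ℤ) (i : ℕ) : zcoeff f i = f.coeff i := by
  simp [zcoeff]

lemma zcoeff_of_neg (f : Polynomial ℤ) {i : ℤ} (hi : i < 0) : zcoeff f i = 0 := by
  simp [zcoeff, hi]

lemma zcoeff_zero (i : ℤ) : zcoeff 0 i = 0 := by
  simp [zcoeff]

lemma zcoeff_add (f g : Polynomial ℤ) (i : ℤ) :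
    zcoeff (f + g) i = zcoeff f i + zcoeff g i := by
  unfold zcoeff; split_ifs <;> simp

lemma zcoeff_X_pow_mul (f : Polynomial ℤ) (e : ℕ) (i : ℤ) :
    zcoeff (Polynomial.X ^ e * f) i = zcoeff f (i - e) := by
  unfold zcoeff
  by_cases h : 0 ≤ i
  · rw [if_pos h, Polynomial.coeff_X_pow_mul']
    by_cases h' : e ≤ i.toNat
    · rw [if_pos h', if_pos (by omega)]
      congr 1; omega
    · rw [if_neg h', if_neg (by omega)]
  · rw [if_neg h, if_neg (by omega)]

lemma zcoeff_qint_mul (f : Polynomial ℤ) (m : ℕ) (i : ℤ) :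
    zcoeff (qint Polynomial.X m * f) i = ∑ t ∈ Finset.range m, zcoeff f (i - t) := by
  induction m with
  | zero => simp [qint, zcoeff_zero]
  | succ m ih =>
    have h : qint (Polynomial.X : Polynomial ℤ) (m + 1)
        = qint Polynomial.X m + Polynomial.X ^ m := by
      simp [qint, Finset.sum_range_succ]
    rw [h, add_mul, zcoeff_add, ih, zcoeff_X_pow_mul, Finset.sum_range_succ]

/-- `f` has coefficients symmetric about `D / 2` and weakly increasing up to there. -/
def SymmUnimodal (f : Polynomial ℤ) (D : ℤ) : Prop :=
  (∀ i, zcoeff f i = zcoeff f (D - i)) ∧ ∀ i, 2 * i + 1 ≤ D → zcoeff f i ≤ zcoeff f (i + 1)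

namespace SymmUnimodal

lemma zero (D : ℤ) : SymmUnimodal 0 D := by
  simp [SymmUnimodal, zcoeff_zero]

lemma add {f g : Polynomial ℤ} {D : ℤ} (hf : SymmUnimodal f D) (hg : SymmUnimodal g D) :
    SymmUnimodal (f + g) D := by
  refine ⟨fun i => ?_, fun i hi => ?_⟩
  · rw [zcoeff_add, zcoeff_add, ← hf.1, ← hg.1]
  · rw [zcoeff_add, zcoeff_add]
    exact add_le_add (hf.2 i hi) (hg.2 i hi)

lemma X_pow_mul {f : Polynomial ℤ} {D : ℤ} (hf : SymmUnimodal f D) (e : ℕ) :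
    SymmUnimodal (Polynomial.X ^ e * f) (D + 2 * e) := by
  refine ⟨fun i => ?_, fun i hi => ?_⟩
  · rw [zcoeff_X_pow_mul, zcoeff_X_pow_mul, hf.1]
    congr 1; ring
  · rw [zcoeff_X_pow_mul, zcoeff_X_pow_mul]
    have := hf.2 (i - e) (by linarith)
    rwa [show i - e + 1 = i + 1 - (e : ℤ) by ring] at this

lemma mono {f : Polynomial ℤ} {D : ℤ} (hf : SymmUnimodal f D) {i j : ℤ} (hij : i ≤ j)
    (hD : i + j ≤ D) : zcoeff f i ≤ zcoeff f j := by
  have key : ∀ (t : ℕ) (i : ℤ), 2 * (i + t) ≤ D + 1 → zcoeff f i ≤ zcoeff f (i + t) := by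
    intro t
    induction t with
    | zero => simp
    | succ t ih =>
      intro i h
      push_cast at h ⊢
      refine (ih i (by linarith)).trans ?_
      rw [← add_assoc]
      exact hf.2 _ (by linarith)
  rcases le_total (2 * j) (D + 1) with h | h
  · have := key (j - i).toNat i (by omega)
    rwa [show i + ((j - i).toNat : ℤ) = j by omega] at this
  · rw [hf.1 j]
    have := key (D - j - i).toNat i (by omega)
    rwa [show i + ((D - j - i).toNat : ℤ) = D - j by omega] at this

lemma anti {f : Polynomial ℤ} {D : ℤ} (hf : SymmUnimodal f D) {i j : ℤ} (hij : i ≤ j)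
    (hD : D ≤ i + j) : zcoeff f j ≤ zcoeff f i := by
  rw [hf.1 i, hf.1 j]
  exact hf.mono (by linarith) (by linarith)

lemma nonneg {f : Polynomial ℤ} {D : ℤ} (hf : SymmUnimodal f D) (i : ℤ) : 0 ≤ zcoeff f i := by
  have h := hf.mono (i := min (-1) (min i (D - i))) (j := i) (by omega) (by omega)
  rwa [zcoeff_of_neg f (by omega)] at h

lemma qint_mul {f : Polynomial ℤ} {D : ℤ} (hf : SymmUnimodal f D) (m : ℕ) :
    SymmUnimodal (qint Polynomial.X m * f) (D + m - 1) := by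
  refine ⟨fun i => ?_, fun i hi => ?_⟩
  · rw [zcoeff_qint_mul, zcoeff_qint_mul, ← Finset.sum_range_reflect]
    refine Finset.sum_congr rfl fun t ht => ?_
    have ht := Finset.mem_range.1 ht
    rw [hf.1]
    congr 1; omega
  · rw [zcoeff_qint_mul, zcoeff_qint_mul]
    have h := Finset.sum_range_succ (fun t : ℕ => zcoeff f (i + 1 - t)) m
    rw [Finset.sum_range_succ'] at h
    have h' : ∑ t ∈ Finset.range m, zcoeff f (i + 1 - ((t + 1 : ℕ) : ℤ))
        = ∑ t ∈ Finset.range m, zcoeff f (i - t) :=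
      Finset.sum_congr rfl fun t _ => by congr 1; push_cast; ring
    have := hf.mono (i := i + 1 - m) (j := i + 1) (by omega) (by omega)
    simp only [h', Nat.cast_zero, sub_zero] at h
    linarith

lemma zsuz {f : Polynomial ℤ} {D : ℤ} (hf : SymmUnimodal f D) : ZSUZ f D := by
  by_cases h0 : f = 0
  · exact Or.inl h0
  have hN : zcoeff f f.natDegree ≠ 0 := by
    rw [zcoeff_natCast]; simpa using h0
  have ht : zcoeff f f.natTrailingDegree ≠ 0 := by
    rw [zcoeff_natCast]
    exact Polynomial.trailingCoeff_nonzero_iff_nonzero.2 h0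
  have hsum : (f.natTrailingDegree : ℤ) + f.natDegree = D := by
    rw [hf.1] at hN ht
    have h1 : 0 ≤ D - f.natDegree := by
      by_contra h; exact hN (zcoeff_of_neg f (by omega))
    have h2 : 0 ≤ D - f.natTrailingDegree := by
      by_contra h; exact ht (zcoeff_of_neg f (by omega))
    lift D - f.natDegree to ℕ using h1 with a ha
    lift D - f.natTrailingDegree to ℕ using h2 with b hb
    rw [zcoeff_natCast] at hN ht
    have h3 := Polynomial.natTrailingDegree_le_of_ne_zero hN
    have h4 := Polynomial.le_natDegree_of_ne_zero ht
    omega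
  have hle := Polynomial.natTrailingDegree_le_natDegree f
  refine Or.inr ⟨fun i => ?_, fun k hk => ?_, ⟨(D / 2).toNat, fun i j hij hj => ?_,
    fun i j hi hij => ?_⟩, hsum⟩
  · rw [← zcoeff_natCast]; exact hf.nonneg _
  · rw [← zcoeff_natCast, ← zcoeff_natCast, hf.1]
    congr 1; omega
  · rw [← zcoeff_natCast, ← zcoeff_natCast]
    exact hf.mono (by omega) (by omega)
  · rcases hij.eq_or_lt with rfl | hlt
    · exact le_rfl
    rw [← zcoeff_natCast, ← zcoeff_natCast]
    exact hf.anti (by omega) (by omega)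

end SymmUnimodal

section RookRecursion

variable {R : Type*} [CommRing R] {n : ℕ}

/-- The board formed by the first `m` columns of the board `c`. -/
def truncCols (c : Fin n → ℕ) (m : ℕ) : Fin n → ℕ := fun j => if (j : ℕ) < m then c j else 0

/-- The rows meeting column `j` of the board `c` that hold no rook of `C`. -/
def freeRows (c : Fin n → ℕ) (j : Fin n) (C : Finset (Fin n × Fin n)) : Finset (Fin n) :=
  Finset.univ.filter fun i => (i : ℕ) < c j ∧ i ∉ C.image Prod.fst

lemma mem_freeRows {c : Fin n → ℕ} {j : Fin n} {C : Finset (Fin n × Fin n)} {i : Fin n} :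
    i ∈ freeRows c j C ↔ (i : ℕ) < c j ∧ ∀ r ∈ C, r.1 ≠ i := by
  simp only [freeRows, Finset.mem_filter, Finset.mem_univ, true_and, Finset.mem_image, not_exists,
    not_and]

lemma mem_boardSq_truncCols {c : Fin n → ℕ} {m : ℕ} {s : Fin n × Fin n} :
    s ∈ boardSq n (truncCols c m) ↔ (s.2 : ℕ) < m ∧ (s.1 : ℕ) < c s.2 := by
  simp only [boardSq, Finset.mem_filter, Finset.mem_univ, true_and]
  unfold truncCols
  split_ifs with h <;> simp [h]

lemma mem_placements {c : Fin n → ℕ} {k : ℕ} {C : Finset (Fin n × Fin n)} :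
    C ∈ placements n c k ↔ C.card = k ∧ (∀ r ∈ C, (r.1 : ℕ) < c r.2) ∧ NonAttacking C := by
  simp [placements, boardSq, Finset.subset_iff]

lemma mem_placements_truncCols {c : Fin n → ℕ} {m k : ℕ} {C : Finset (Fin n × Fin n)} :
    C ∈ placements n (truncCols c m) k ↔
      C.card = k ∧ (∀ r ∈ C, (r.2 : ℕ) < m ∧ (r.1 : ℕ) < c r.2) ∧ NonAttacking C := by
  simp only [placements, Finset.mem_filter, Finset.mem_univ, true_and, Finset.subset_iff,
    mem_boardSq_truncCols]

lemma card_freeRows {c : Fin n → ℕ} (hc : IsFerrers n c) {k : ℕ} (j : Fin n)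
    {C : Finset (Fin n × Fin n)} (hC : C ∈ placements n (truncCols c j) k) :
    (freeRows c j C).card + k = c j := by
  obtain ⟨hk, hb, hna⟩ := mem_placements_truncCols.1 hC
  have hinj : Set.InjOn Prod.fst (C : Set (Fin n × Fin n)) := by
    intro r hr r' hr' h
    by_contra hne
    exact (hna r hr r' hr' hne).1 h
  have hU : (Finset.univ.filter fun i : Fin n => (i : ℕ) < c j).card = c j := by
    rw [Fin.card_filter_val_lt]
    exact min_eq_right (hc.2 j)
  have hsub : C.image Prod.fst ⊆ Finset.univ.filter fun i : Fin n => (i : ℕ) < c j := by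
    intro i hi
    obtain ⟨r, hr, rfl⟩ := Finset.mem_image.1 hi
    have h := hb r hr
    simpa using h.2.trans_le (hc.1 (Fin.le_def.2 h.1.le))
  have hF : freeRows c j C
      = (Finset.univ.filter fun i : Fin n => (i : ℕ) < c j) \ C.image Prod.fst := by
    ext i; simp [freeRows]
  rw [hF, Finset.card_sdiff_of_subset hsub, hU, Finset.card_image_of_injOn hinj, hk]
  have := Finset.card_le_card hsub
  rw [hU, Finset.card_image_of_injOn hinj, hk] at this
  omega

lemma rookInv_truncCols_succ {c : Fin n → ℕ} {k : ℕ} (j : Fin n)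
    {C : Finset (Fin n × Fin n)} (hC : C ∈ placements n (truncCols c j) k) :
    rookInv n (truncCols c (j + 1)) C = rookInv n (truncCols c j) C + (freeRows c j C).card := by
  obtain ⟨hk, hb, hna⟩ := mem_placements_truncCols.1 hC
  unfold rookInv
  rw [← Finset.card_image_of_injective (freeRows c j C) (Prod.mk_left_injective j),
    ← Finset.card_union_of_disjoint]
  · congr 1
    ext ⟨a, b⟩
    simp only [mem_boardSq_truncCols, Finset.mem_filter, Finset.mem_union,
      Finset.mem_image, mem_freeRows, Prod.mk.injEq]
    constructor
    · rintro ⟨h1, h2, h3⟩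
      by_cases hbj : (b : ℕ) < j
      · left
        exact ⟨⟨hbj, h1.2⟩, h2, h3⟩
      · right
        obtain rfl : b = j := Fin.ext (by omega)
        replace h1 := h1.2
        exact ⟨a, ⟨h1, fun r hr h => (h3 r hr).2 ⟨h, Fin.lt_def.2 (hb r hr).1⟩⟩, rfl, rfl⟩
    · rintro (⟨h1, h2, h3⟩ | ⟨a', ⟨h1, h2⟩, rfl, rfl⟩)
      · exact ⟨⟨by omega, h1.2⟩, h2, h3⟩
      · refine ⟨⟨Nat.lt_succ_self _, h1⟩, fun h => h2 _ h rfl, fun r hr => ⟨?_, ?_⟩⟩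
        · rintro ⟨h, -⟩
          have := (hb r hr).1
          rw [h] at this; omega
        · rintro ⟨h, -⟩
          exact h2 r hr h
  · rw [Finset.disjoint_left]
    rintro ⟨a, b⟩ h h'
    simp only [mem_boardSq_truncCols, Finset.mem_filter, Finset.mem_image,
      Prod.mk.injEq] at h h'
    obtain ⟨_, _, _, rfl⟩ := h'
    simp at h

lemma rookInv_insert {c : Fin n → ℕ} {k : ℕ} (j : Fin n)
    {C : Finset (Fin n × Fin n)} (hC : C ∈ placements n (truncCols c j) k) {i : Fin n}
    (hi : i ∈ freeRows c j C) :
    rookInv n (truncCols c (j + 1)) (insert (i, j) C)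
      = rookInv n (truncCols c j) C + ((freeRows c j C).filter (i < ·)).card := by
  obtain ⟨hk, hb, hna⟩ := mem_placements_truncCols.1 hC
  unfold rookInv
  rw [← Finset.card_image_of_injective ((freeRows c j C).filter (i < ·))
      (Prod.mk_left_injective j), ← Finset.card_union_of_disjoint]
  · congr 1
    ext ⟨a, b⟩
    simp only [mem_boardSq_truncCols, Finset.mem_filter, Finset.mem_union,
      Finset.mem_image, mem_freeRows, Prod.mk.injEq, Finset.mem_insert,
      forall_eq_or_imp, not_or]
    constructor
    · rintro ⟨h1, ⟨h2, h2'⟩, h3', h3⟩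
      by_cases hbj : (b : ℕ) < j
      · left
        exact ⟨⟨hbj, h1.2⟩, h2', h3⟩
      · right
        obtain rfl : b = j := Fin.ext (by omega)
        replace h1 := h1.2
        refine ⟨a, ⟨⟨h1, fun r hr h => (h3 r hr).2 ⟨h, Fin.lt_def.2 (hb r hr).1⟩⟩, ?_⟩, rfl, rfl⟩
        rcases lt_trichotomy i a with h | h | h
        · exact h
        · exact absurd ⟨h.symm, rfl⟩ h2
        · exact absurd ⟨rfl, h⟩ h3'.1
    · rintro (⟨h1, h2, h3⟩ | ⟨a', ⟨⟨h1, h2⟩, h4⟩, rfl, rfl⟩)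
      · have hlt := h1.1
        refine ⟨⟨by omega, h1.2⟩, ⟨?_, h2⟩, ⟨?_, ?_⟩, h3⟩
        · rintro ⟨_, rfl⟩; omega
        · rintro ⟨rfl, _⟩; omega
        · rintro ⟨_, h⟩; exact absurd (Fin.lt_def.1 h) (by omega)
      · refine ⟨⟨Nat.lt_succ_self _, h1⟩, ⟨?_, fun h => h2 _ h rfl⟩, ⟨?_, ?_⟩,
          fun r hr => ⟨?_, ?_⟩⟩
        · rintro ⟨rfl, _⟩; exact lt_irrefl _ h4
        · rintro ⟨_, h⟩; exact lt_asymm h h4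
        · rintro ⟨_, h⟩; exact lt_irrefl _ h
        · rintro ⟨h, -⟩
          have := (hb r hr).1
          rw [h] at this; omega
        · rintro ⟨h, -⟩
          exact h2 r hr h
  · rw [Finset.disjoint_left]
    rintro ⟨a, b⟩ h h'
    simp only [mem_boardSq_truncCols, Finset.mem_filter, Finset.mem_image,
      Prod.mk.injEq] at h h'
    obtain ⟨_, _, _, rfl⟩ := h'
    simp at h

lemma sum_pow_card_filter_lt (q : R) (F : Finset (Fin n)) :
    ∑ i ∈ F, q ^ (F.filter (i < ·)).card = qint q F.card := by
  induction F using Finset.induction_on_min with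
  | empty => simp [qint]
  | insert a s h ih =>
    have ha : a ∉ s := fun h' => lt_irrefl _ (h a h')
    rw [Finset.sum_insert ha, Finset.card_insert_of_notMem ha, qint, Finset.sum_range_succ,
      ← qint, ← ih, add_comm]
    congr 1
    · refine Finset.sum_congr rfl fun i hi => ?_
      rw [Finset.filter_insert, if_neg (lt_asymm (h i hi))]
    · rw [Finset.filter_insert, if_neg (lt_irrefl a), Finset.filter_true_of_mem h]

lemma placements_truncCols_succ_filter (c : Fin n → ℕ) (j : Fin n) (k : ℕ) :
    (placements n (truncCols c (j + 1)) k).filter (fun C => ∀ r ∈ C, r.2 ≠ j)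
      = placements n (truncCols c j) k := by
  ext C
  rw [Finset.mem_filter, mem_placements_truncCols, mem_placements_truncCols]
  constructor
  · rintro ⟨⟨h1, h2, h3⟩, h4⟩
    refine ⟨h1, fun r hr => ⟨?_, (h2 r hr).2⟩, h3⟩
    have := (h2 r hr).1
    have h5 : (r.2 : ℕ) ≠ j := fun h => h4 r hr (Fin.ext h)
    omega
  · rintro ⟨h1, h2, h3⟩
    refine ⟨⟨h1, fun r hr => ⟨?_, (h2 r hr).2⟩, h3⟩, fun r hr h => ?_⟩
    · have := (h2 r hr).1
      omega
    · have := (h2 r hr).1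
      rw [h] at this; omega

lemma sum_placements_filter_rook (q : R) (c : Fin n → ℕ) (j : Fin n) (k : ℕ) :
    ∑ C ∈ (placements n (truncCols c (j + 1)) (k + 1)).filter (fun C => ¬ ∀ r ∈ C, r.2 ≠ j),
        q ^ rookInv n (truncCols c (j + 1)) C
      = ∑ C ∈ placements n (truncCols c j) k, ∑ i ∈ freeRows c j C,
          q ^ (rookInv n (truncCols c j) C + ((freeRows c j C).filter (i < ·)).card) := by
  rw [Finset.sum_sigma']
  symm
  have hcol : ∀ {C : Finset (Fin n × Fin n)}, C ∈ placements n (truncCols c j) k →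
      ∀ r ∈ C, r.2 ≠ j := by
    intro C hC r hr h
    have := ((mem_placements_truncCols.1 hC).2.1 r hr).1
    rw [h] at this; omega
  refine Finset.sum_bij (fun p _ => insert (p.2, j) p.1) ?_ ?_ ?_ ?_
  · rintro ⟨C, i⟩ h
    obtain ⟨hC, hi⟩ := Finset.mem_sigma.1 h
    have hcolC := hcol hC
    obtain ⟨hk, hb, hna⟩ := mem_placements_truncCols.1 hC
    have hi := mem_freeRows.1 hi
    simp only at hi hk hb hna hcolC ⊢
    rw [Finset.mem_filter, mem_placements_truncCols]
    refine ⟨⟨?_, ?_, ?_⟩, fun h => h _ (Finset.mem_insert_self _ _) rfl⟩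
    · rw [Finset.card_insert_of_notMem fun h => hcolC _ h rfl, hk]
    · intro r hr
      rcases Finset.mem_insert.1 hr with rfl | hr
      · exact ⟨Nat.lt_succ_self _, hi.1⟩
      · exact ⟨(hb r hr).1.trans (Nat.lt_succ_self _), (hb r hr).2⟩
    · intro r hr r' hr' hne
      rcases Finset.mem_insert.1 hr with rfl | hr <;> rcases Finset.mem_insert.1 hr' with rfl | hr'
      · exact absurd rfl hne
      · exact ⟨(hi.2 r' hr').symm, (hcolC r' hr').symm⟩
      · exact ⟨hi.2 r hr, hcolC r hr⟩
      · exact hna r hr r' hr' hne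
  · rintro ⟨C, i⟩ h ⟨C', i'⟩ h' heq
    have h1 := hcol (Finset.mem_sigma.1 h).1
    have h2 := hcol (Finset.mem_sigma.1 h').1
    simp only at h1 h2 heq
    have hi : i = i' := by
      have : (i, j) ∈ insert (i', j) C' := heq ▸ Finset.mem_insert_self _ _
      rcases Finset.mem_insert.1 this with h | h
      · exact congrArg Prod.fst h
      · exact absurd rfl (h2 _ h)
    subst hi
    have hCC : C = C' := by
      have h1 : (i, j) ∉ C := fun h => h1 _ h rfl
      have h2 : (i, j) ∉ C' := fun h => h2 _ h rfl
      rw [← Finset.erase_insert h1, heq, Finset.erase_insert h2]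
    rw [hCC]
  · intro C hC
    obtain ⟨hC, hr⟩ := Finset.mem_filter.1 hC
    obtain ⟨hk, hb, hna⟩ := mem_placements_truncCols.1 hC
    push Not at hr
    obtain ⟨⟨i, j'⟩, hr, rfl⟩ := hr
    simp only at hr hb ⊢
    refine ⟨⟨C.erase (i, j'), i⟩, ?_, Finset.insert_erase hr⟩
    rw [Finset.mem_sigma, mem_placements_truncCols, mem_freeRows]
    refine ⟨⟨?_, ?_, ?_⟩, (hb _ hr).2, ?_⟩
    · rw [Finset.card_erase_of_mem hr, hk]; rfl
    · intro r hr'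
      obtain ⟨hne, hr'⟩ := Finset.mem_erase.1 hr'
      refine ⟨?_, (hb r hr').2⟩
      have h1 := (hb r hr').1
      have h2 : (r.2 : ℕ) ≠ j' := fun h => (hna r hr' _ hr hne).2 (Fin.ext h)
      omega
    · intro r hr1 r' hr2
      exact hna r (Finset.mem_of_mem_erase hr1) r' (Finset.mem_of_mem_erase hr2)
    · intro r hr'
      obtain ⟨hne, hr'⟩ := Finset.mem_erase.1 hr'
      exact (hna r hr' _ hr hne).1
  · rintro ⟨C, i⟩ h
    obtain ⟨hC, hi⟩ := Finset.mem_sigma.1 h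
    rw [rookInv_insert j hC hi]

lemma sum_placements_no_rook (q : R) {c : Fin n → ℕ} (hc : IsFerrers n c) (j : Fin n) (k : ℕ) :
    ∑ C ∈ (placements n (truncCols c (j + 1)) k).filter (fun C => ∀ r ∈ C, r.2 ≠ j),
        q ^ rookInv n (truncCols c (j + 1)) C
      = q ^ (c j - k) * qRook q n (truncCols c j) k := by
  rw [placements_truncCols_succ_filter, qRook, Finset.mul_sum]
  refine Finset.sum_congr rfl fun C hC => ?_
  have := card_freeRows hc j hC
  rw [rookInv_truncCols_succ j hC, add_comm, pow_add]
  congr 2; omega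

/-- Deletion of the last column in the `q`-rook polynomials of a Ferrers board. -/
lemma qRook_truncCols_succ (q : R) {c : Fin n → ℕ} (hc : IsFerrers n c) (j : Fin n) (k : ℕ) :
    qRook q n (truncCols c (j + 1)) (k + 1)
      = q ^ (c j - (k + 1)) * qRook q n (truncCols c j) (k + 1)
        + qint q (c j - k) * qRook q n (truncCols c j) k := by
  rw [← sum_placements_no_rook q hc, qRook,
    ← Finset.sum_filter_add_sum_filter_not _ (fun C => ∀ r ∈ C, r.2 ≠ j),
    sum_placements_filter_rook, qRook, Finset.mul_sum]
  congr 1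
  refine Finset.sum_congr rfl fun C hC => ?_
  have := card_freeRows hc j hC
  simp only [pow_add]
  rw [← Finset.mul_sum, sum_pow_card_filter_lt, mul_comm]
  congr 2; omega

lemma qRook_truncCols_succ_zero (q : R) {c : Fin n → ℕ} (hc : IsFerrers n c) (j : Fin n) :
    qRook q n (truncCols c (j + 1)) 0 = q ^ c j * qRook q n (truncCols c j) 0 := by
  have h := sum_placements_no_rook q hc j 0
  rw [Finset.filter_true_of_mem] at h
  · exact h
  · intro C hC
    rw [Finset.card_eq_zero.1 (mem_placements.1 hC).1]
    simp

lemma qRook_truncCols_zero (q : R) (c : Fin n → ℕ) (k : ℕ) :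
    qRook q n (truncCols c 0) k = if k = 0 then 1 else 0 := by
  have hempty : ∀ C ∈ placements n (truncCols c 0) k, C = ∅ := fun C hC =>
    Finset.eq_empty_of_forall_notMem fun r hr =>
      absurd ((mem_placements_truncCols.1 hC).2.1 r hr).1 (Nat.not_lt_zero _)
  split_ifs with h
  · subst h
    have : placements n (truncCols c 0) 0 = {∅} := by
      ext C
      rw [Finset.mem_singleton]
      refine ⟨hempty C, ?_⟩
      rintro rfl
      simp [mem_placements, NonAttacking]
    rw [qRook, this, Finset.sum_singleton, rookInv]
    simp [boardSq, truncCols]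
  · refine Finset.sum_eq_zero fun C hC => ?_
    have := (mem_placements.1 hC).1
    rw [hempty C hC] at this
    exact absurd this.symm h

lemma qRook_truncCols_eq_zero_of_lt (q : R) {c : Fin n → ℕ} (hc : IsFerrers n c) (j : Fin n)
    {k : ℕ} (hk : c j < k) : qRook q n (truncCols c j) k = 0 := by
  refine Finset.sum_eq_zero fun C hC => ?_
  have := card_freeRows hc j hC
  omega

lemma truncCols_self (c : Fin n → ℕ) : truncCols c n = c := by
  ext j; simp [truncCols]

end RookRecursion

section HitStep

variable {K : Type*} [Field K]

/-- The effect on the generating polynomial of `q`-hit numbers of an `m`-column board of adding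
a column of height `m + d`. -/
noncomputable def hitStep (q : K) (m : ℕ) (d : ℤ) (H : Polynomial K) : Polynomial K :=
  Polynomial.C (1 - q)⁻¹ * ((Polynomial.X - Polynomial.C (q ^ (m + 1))) * H
    - Polynomial.C (q ^ (d + m)) * (Polynomial.X - 1) * H.comp (Polynomial.C q⁻¹ * Polynomial.X))

/-- The generating polynomial obtained by iterating `hitStep` along a list of shifted column
heights. -/
noncomputable def hitList (q : K) : List ℤ → Polynomial K
  | [] => 1
  | d :: l => hitStep q l.length d (hitList q l)

lemma hitStep_comm {q : K} (hq : q ≠ 0) (m : ℕ) (d e : ℤ) (H : Polynomial K) :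
    hitStep q (m + 1) e (hitStep q m d H) = hitStep q (m + 1) d (hitStep q m e H) := by
  have key : ∀ d : ℤ, Polynomial.C (q ^ (d + ((m + 1 : ℕ) : ℤ)))
      = Polynomial.C q * Polynomial.C (q ^ (d + m)) := by
    intro d
    rw [← Polynomial.C_mul, ← zpow_one_add₀ hq]
    congr 2; push_cast; ring
  have hinv : Polynomial.C q * Polynomial.C q⁻¹ = 1 := by
    rw [← Polynomial.C_mul, mul_inv_cancel₀ hq, Polynomial.C_1]
  simp only [hitStep, key, Polynomial.mul_comp, Polynomial.sub_comp, Polynomial.C_comp,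
    Polynomial.X_comp, Polynomial.one_comp, pow_succ, Polynomial.C_mul]
  generalize Polynomial.C (q ^ (d + m)) = u
  generalize Polynomial.C (q ^ (e + m)) = v
  generalize Polynomial.C (q ^ m) = w
  generalize (H.comp (Polynomial.C q⁻¹ * Polynomial.X)).comp (Polynomial.C q⁻¹ * Polynomial.X) = H2
  generalize H.comp (Polynomial.C q⁻¹ * Polynomial.X) = H1
  generalize Polynomial.C q⁻¹ = p at *
  generalize Polynomial.C q = r at *
  linear_combination (Polynomial.C (1 - q)⁻¹) ^ 2 * (Polynomial.X - 1) * H1 * (u - v) *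
    Polynomial.X * hinv

lemma hitList_perm {q : K} (hq : q ≠ 0) {l l' : List ℤ} (h : l.Perm l') :
    hitList q l = hitList q l' := by
  induction h with
  | nil => rfl
  | cons d h ih => rw [hitList, hitList, h.length_eq, ih]
  | swap d e l => exact hitStep_comm hq _ _ _ _
  | trans _ _ ih₁ ih₂ => exact ih₁.trans ih₂

lemma hitStep_sum {ι : Type*} (q : K) (m : ℕ) (d : ℤ) (s : Finset ι) (a : ι → K)
    (f : ι → Polynomial K) :
    hitStep q m d (∑ j ∈ s, Polynomial.C (a j) * f j)
      = ∑ j ∈ s, Polynomial.C (a j) * hitStep q m d (f j) := by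
  simp only [hitStep]
  rw [Polynomial.sum_comp, Finset.mul_sum, Finset.mul_sum, ← Finset.sum_sub_distrib,
    Finset.mul_sum]
  refine Finset.sum_congr rfl fun j _ => ?_
  rw [Polynomial.mul_comp, Polynomial.C_comp]
  ring

/-- The product `∏_{i=j+1}^m (x - q^i)`. -/
noncomputable def hitBasis (q : K) (j m : ℕ) : Polynomial K :=
  ∏ i ∈ Finset.Icc (j + 1) m, (Polynomial.X - Polynomial.C (q ^ i))

lemma hitBasis_eq_prod_range (q : K) (j t : ℕ) :
    hitBasis q j (j + t)
      = ∏ i ∈ Finset.range t, (Polynomial.X - Polynomial.C (q ^ (j + 1 + i))) := by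
  rw [hitBasis, ← Finset.Ico_add_one_right_eq_Icc, Finset.prod_Ico_eq_prod_range]
  congr 2; omega

lemma hitBasis_comp {q : K} (hq : q ≠ 0) (j t : ℕ) :
    (hitBasis q j (j + t)).comp (Polynomial.C q⁻¹ * Polynomial.X)
      = Polynomial.C (q⁻¹ ^ t) * hitBasis q (j + 1) (j + t + 1) := by
  rw [add_right_comm, hitBasis_eq_prod_range, hitBasis_eq_prod_range, Polynomial.prod_comp]
  have h : ∀ i ∈ Finset.range t,
      (Polynomial.X - Polynomial.C (q ^ (j + 1 + i))).comp (Polynomial.C q⁻¹ * Polynomial.X)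
        = Polynomial.C q⁻¹ * (Polynomial.X - Polynomial.C (q ^ (j + 1 + 1 + i))) := by
    intro i _
    rw [Polynomial.sub_comp, Polynomial.X_comp, Polynomial.C_comp, mul_sub, ← Polynomial.C_mul]
    congr 2
    rw [show j + 1 + 1 + i = j + 1 + i + 1 by ring, pow_succ']
    field_simp
  rw [Finset.prod_congr rfl h, Finset.prod_mul_distrib, Finset.prod_const, Finset.card_range,
    Polynomial.C_pow]

lemma qint_eq_div {q : K} (hq1 : q ≠ 1) (m : ℕ) : qint q m = (1 - q ^ m) / (1 - q) := by
  rw [qint, geom_sum_eq hq1, ← neg_div_neg_eq, neg_sub, neg_sub]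

lemma qint_toNat_eq_div {q : K} (hq1 : q ≠ 1) {z : ℤ} (hz : 0 ≤ z) :
    qint q z.toNat = (1 - q ^ z) / (1 - q) := by
  rw [qint_eq_div hq1, ← zpow_natCast, Int.toNat_of_nonneg hz]

lemma hitStep_hitBasis {q : K} (hq : q ≠ 0) (hq1 : q ≠ 1) {j m : ℕ} (hj : j ≤ m) (d : ℤ) :
    hitStep q m d (hitBasis q j m)
      = Polynomial.C ((1 - q ^ (d + j)) / (1 - q)) * hitBasis q j (m + 1)
        + Polynomial.C (qint q (j + 1) * q ^ (d + j)) * hitBasis q (j + 1) (m + 1) := by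
  obtain ⟨t, rfl⟩ := Nat.exists_eq_add_of_le hj
  have h1 : (Polynomial.X - Polynomial.C (q ^ (j + t + 1))) * hitBasis q j (j + t)
      = hitBasis q j (j + t + 1) := by
    rw [add_assoc j t 1, hitBasis_eq_prod_range, hitBasis_eq_prod_range, Finset.prod_range_succ,
      mul_comm]
    congr 4; ring
  have h2 : hitBasis q j (j + t + 1)
      = (Polynomial.X - Polynomial.C (q ^ (j + 1))) * hitBasis q (j + 1) (j + t + 1) := by
    rw [add_right_comm j t 1, hitBasis_eq_prod_range, add_right_comm j 1 t, add_assoc j t 1,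
      hitBasis_eq_prod_range, Finset.prod_range_succ', mul_comm]
    congr 1
    refine Finset.prod_congr rfl fun i _ => ?_
    congr 3; ring
  have h3 : q ^ (d + ((j + t : ℕ) : ℤ)) = q ^ (d + j) * q ^ t := by
    rw [← zpow_natCast q t, ← zpow_add₀ hq]
    congr 1; push_cast; ring
  have h4 : Polynomial.C (q ^ t) * Polynomial.C (q⁻¹ ^ t) = 1 := by
    rw [← Polynomial.C_mul, ← mul_pow, mul_inv_cancel₀ hq, one_pow, Polynomial.C_1]
  rw [hitStep, h1, hitBasis_comp hq, h2, h3, qint_eq_div hq1]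
  simp only [div_eq_mul_inv, Polynomial.C_mul, Polynomial.C_sub, Polynomial.C_1]
  linear_combination (-Polynomial.C (1 - q)⁻¹ * Polynomial.C (q ^ (d + j)) * (Polynomial.X - 1) *
    hitBasis q (j + 1) (j + t + 1)) * h4

lemma hitStep_coeff_zero {q : K} (hq : q ≠ 0) (m : ℕ) (d : ℤ) (H : Polynomial K) :
    (hitStep q m d H).coeff 0 = q ^ (d + m) * ((1 - q ^ (1 - d)) / (1 - q)) * H.coeff 0 := by
  have h : q ^ (d + m) * q ^ (1 - d) = q ^ (m + 1) := by
    rw [← zpow_add₀ hq, ← zpow_natCast]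
    congr 1; push_cast; ring
  simp only [hitStep, Polynomial.coeff_C_mul, mul_assoc, Polynomial.coeff_sub, sub_mul,
    Polynomial.coeff_X_mul_zero, one_mul, Polynomial.comp_C_mul_X_coeff, pow_zero, mul_one]
  rw [← h]
  ring

lemma hitStep_coeff_succ {q : K} (hq : q ≠ 0) (m : ℕ) (d : ℤ) (H : Polynomial K) (j : ℕ) :
    (hitStep q m d H).coeff (j + 1)
      = (1 - q ^ (d + m - j)) / (1 - q) * H.coeff j
        + q ^ (d + m - (j + 1)) * ((1 - q ^ (2 + j - d)) / (1 - q)) * H.coeff (j + 1) := by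
  have h : q ^ (d + m - (j + 1)) * q ^ (2 + j - d) = q ^ (m + 1) := by
    rw [← zpow_add₀ hq, ← zpow_natCast]
    congr 1; push_cast; ring
  have h1 : q ^ (d + m - (j : ℤ)) = q ^ (d + m) * q⁻¹ ^ j := by
    rw [zpow_sub₀ hq, zpow_natCast, inv_pow, div_eq_mul_inv]
  have h2 : q ^ (d + m - ((j : ℤ) + 1)) = q ^ (d + m) * q⁻¹ ^ (j + 1) := by
    rw [zpow_sub₀ hq, ← Nat.cast_succ, zpow_natCast, inv_pow, div_eq_mul_inv]
  simp only [hitStep, Polynomial.coeff_C_mul, mul_assoc, Polynomial.coeff_sub, sub_mul,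
    Polynomial.coeff_X_mul, one_mul, Polynomial.comp_C_mul_X_coeff]
  rw [← h, h1, h2]
  ring

/-- The generating polynomial of the `q`-hit numbers of the first `m` columns of a board. -/
noncomputable def truncHitGen (q : K) {n : ℕ} (c : Fin n → ℕ) (m : ℕ) : Polynomial K :=
  ∑ j ∈ Finset.range (m + 1),
    Polynomial.C (qfact q j * qRook q n (truncCols c m) (m - j)) * hitBasis q j m

lemma qRook_truncCols_eq_zero (q : K) {n : ℕ} {c : Fin n → ℕ} (hc : IsFerrers n c) {m k : ℕ}
    (hm : m ≤ n) (hk : m < k) : qRook q n (truncCols c m) k = 0 := by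
  induction m generalizing k with
  | zero => rw [qRook_truncCols_zero, if_neg (by omega)]
  | succ m ih =>
    obtain ⟨k, rfl⟩ := Nat.exists_eq_add_of_lt (Nat.zero_lt_of_lt hk)
    have h := qRook_truncCols_succ q hc ⟨m, hm⟩ (0 + k)
    simp only at h
    rw [h, ih (by omega) (by omega), ih (by omega) (by omega), mul_zero, mul_zero, add_zero]

lemma truncHitGen_succ {q : K} (hq : q ≠ 0) (hq1 : q ≠ 1) {n : ℕ} {c : Fin n → ℕ}
    (hc : IsFerrers n c) {m : ℕ} (hm : m < n) :
    truncHitGen q c (m + 1) = hitStep q m (c ⟨m, hm⟩ - m) (truncHitGen q c m) := by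
  set d : ℤ := c ⟨m, hm⟩ - m with hd
  set r := fun k => qRook q n (truncCols c m) k with hr
  have hr0 : r (m + 1) = 0 := qRook_truncCols_eq_zero q hc hm.le (Nat.lt_succ_self m)
  have hrlt : ∀ k, c ⟨m, hm⟩ < k → r k = 0 := fun k hk =>
    qRook_truncCols_eq_zero_of_lt q hc ⟨m, hm⟩ hk
  have hrec : ∀ j ∈ Finset.range (m + 1), qRook q n (truncCols c (m + 1)) (m + 1 - j)
      = q ^ (d + j - 1) * r (m + 1 - j) + (1 - q ^ (d + j)) / (1 - q) * r (m - j) := by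
    intro j hj
    have hj := Finset.mem_range.1 hj
    have h := qRook_truncCols_succ q hc ⟨m, hm⟩ (m - j)
    simp only at h
    rw [show m + 1 - j = m - j + 1 by omega, h]
    congr 1
    · by_cases hle : m - j + 1 ≤ c ⟨m, hm⟩
      · rw [← zpow_natCast, show ((c ⟨m, hm⟩ - (m - j + 1) : ℕ) : ℤ) = d + j - 1 by omega]
      · rw [hrlt _ (by omega)]
        simp only [hr] at hrlt
        rw [hrlt _ (by omega)]; simp
    · by_cases hle : m - j ≤ c ⟨m, hm⟩
      · rw [show c ⟨m, hm⟩ - (m - j) = (d + j).toNat by omega, qint_toNat_eq_div hq1 (by omega)]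
      · rw [hrlt _ (by omega)]
        simp only [hr] at hrlt
        rw [hrlt _ (by omega)]; simp
  have hlast : qRook q n (truncCols c (m + 1)) 0
      = q ^ (d + ((m + 1 : ℕ) : ℤ) - 1) * r (m + 1 - (m + 1)) := by
    have h := qRook_truncCols_succ_zero q hc ⟨m, hm⟩
    simp only at h
    rw [h, show d + ((m + 1 : ℕ) : ℤ) - 1 = (c ⟨m, hm⟩ : ℕ) by omega, zpow_natCast,
      Nat.sub_self]
  have hsplit : truncHitGen q c (m + 1)
      = ∑ j ∈ Finset.range (m + 1 + 1),
          Polynomial.C (qfact q j * (q ^ (d + j - 1) * r (m + 1 - j))) * hitBasis q j (m + 1)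
        + ∑ j ∈ Finset.range (m + 1),
          Polynomial.C (qfact q j * ((1 - q ^ (d + j)) / (1 - q) * r (m - j)))
            * hitBasis q j (m + 1) := by
    rw [truncHitGen, Finset.sum_range_succ, Finset.sum_range_succ _ (m + 1), add_right_comm,
      ← Finset.sum_add_distrib, Nat.sub_self (m + 1), hlast, Nat.sub_self (m + 1)]
    congr 1
    refine Finset.sum_congr rfl fun j hj => ?_
    rw [hrec j hj, mul_add, Polynomial.C_add, add_mul]
  rw [hsplit, Finset.sum_range_succ', Nat.sub_zero, hr0, mul_zero, mul_zero, Polynomial.C_0,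
    zero_mul, add_zero, ← Finset.sum_add_distrib, truncHitGen, hitStep_sum]
  refine Finset.sum_congr rfl fun j hj => ?_
  have hj := Finset.mem_range.1 hj
  rw [hitStep_hitBasis hq hq1 (by omega), show m + 1 - (j + 1) = m - j by omega,
    show qfact q (j + 1) = qfact q j * qint q (j + 1) from Finset.prod_range_succ _ _,
    show d + ((j + 1 : ℕ) : ℤ) - 1 = d + j by push_cast; ring]
  simp only [Polynomial.C_mul, hr]
  ring

end HitStep

section Positivity

lemma SymmUnimodal.one : SymmUnimodal 1 0 := by
  have h : ∀ i, zcoeff 1 i = if i = 0 then 1 else 0 := by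
    intro i
    unfold zcoeff
    split_ifs with h1 h2 h2
    · simp [h2]
    · rw [Polynomial.coeff_one, if_neg (by omega)]
    · omega
    · rfl
  refine ⟨fun i => ?_, fun i hi => ?_⟩
  · rw [h, h, zero_sub]
    simp only [neg_eq_zero]
  · rw [h, h]
    split_ifs <;> omega

variable {K : Type*} [Field K]

/-- The coefficients of `hitList q l` come from symmetric unimodal polynomials `a j`, which vanish
as far as the entries of `l` force them to. -/
structure IsHitFamily (φ : Polynomial ℤ →+* K) (l : List ℤ) (a : ℕ → Polynomial ℤ) : Prop where
  coeff_eq : ∀ j, (hitList (φ Polynomial.X) l).coeff j = φ (a j)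
  symmUnimodal : ∀ j, SymmUnimodal (a j)
    ((l.map fun d => d - 1).sum + l.length * ((l.length : ℤ) - j))
  le_length : ∀ j, a j ≠ 0 → j ≤ l.length
  le_of_pos : ∀ v ∈ l, 1 ≤ v → ∀ j : ℕ, a j ≠ 0 → v ≤ j
  le_of_nonpos : ∀ v ∈ l, v ≤ 0 → ∀ j : ℕ, a j ≠ 0 → (j : ℤ) ≤ l.length - 1 + v

lemma IsHitFamily.perm {φ : Polynomial ℤ →+* K} (hX : φ Polynomial.X ≠ 0) {l l' : List ℤ}
    {a : ℕ → Polynomial ℤ} (ha : IsHitFamily φ l a) (h : l.Perm l') : IsHitFamily φ l' a where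
  coeff_eq := hitList_perm hX h ▸ ha.coeff_eq
  symmUnimodal := h.length_eq ▸ (h.map fun d => d - 1).sum_eq ▸ ha.symmUnimodal
  le_length := h.length_eq ▸ ha.le_length
  le_of_pos := fun v hv => ha.le_of_pos v (h.mem_iff.2 hv)
  le_of_nonpos := fun v hv => h.length_eq ▸ ha.le_of_nonpos v (h.mem_iff.2 hv)

lemma IsHitFamily.nil (φ : Polynomial ℤ →+* K) :
    IsHitFamily φ [] fun j => if j = 0 then 1 else 0 where
  coeff_eq j := by
    rw [hitList, Polynomial.coeff_one]
    split_ifs <;> simp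
  symmUnimodal j := by
    split_ifs
    · simpa using SymmUnimodal.one
    · exact SymmUnimodal.zero _
  le_length j hj := by
    by_contra h
    exact hj (if_neg fun h0 => h (by rw [h0]; exact Nat.zero_le _))
  le_of_pos v hv := absurd hv List.not_mem_nil
  le_of_nonpos v hv := absurd hv List.not_mem_nil

lemma map_qint (φ : Polynomial ℤ →+* K) (m : ℕ) :
    φ (qint Polynomial.X m) = qint (φ Polynomial.X) m := by
  simp [qint]

/-- The first summand in the recursion for the `j`-th coefficient when `d` is added to a list of
length `m`. -/
noncomputable def hitLower (m : ℕ) (d : ℤ) (a : ℕ → Polynomial ℤ) (j : ℕ) : Polynomial ℤ :=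
  if j = 0 then 0 else qint Polynomial.X (d + m + 1 - j).toNat * a (j - 1)

/-- The second summand in the recursion for the `j`-th coefficient when `d` is added to a list of
length `m`. -/
noncomputable def hitUpper (m : ℕ) (d : ℤ) (a : ℕ → Polynomial ℤ) (j : ℕ) : Polynomial ℤ :=
  Polynomial.X ^ (d + m - j).toNat * (qint Polynomial.X (1 + j - d).toNat * a j)

lemma hitLower_ne_zero {m : ℕ} {d : ℤ} {a : ℕ → Polynomial ℤ} {j : ℕ}
    (h : hitLower m d a j ≠ 0) : 1 ≤ j ∧ a (j - 1) ≠ 0 ∧ (j : ℤ) ≤ d + m := by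
  unfold hitLower at h
  split_ifs at h with h0
  · exact absurd rfl h
  refine ⟨by omega, right_ne_zero_of_mul h, ?_⟩
  by_contra hlt
  rw [show (d + m + 1 - j).toNat = 0 by omega] at h
  simp [qint] at h

lemma hitUpper_ne_zero {m : ℕ} {d : ℤ} {a : ℕ → Polynomial ℤ} {j : ℕ}
    (h : hitUpper m d a j ≠ 0) : a j ≠ 0 ∧ d ≤ j := by
  unfold hitUpper at h
  have h := right_ne_zero_of_mul h
  refine ⟨right_ne_zero_of_mul h, ?_⟩
  by_contra hlt
  rw [show (1 + j - d).toNat = 0 by omega] at h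
  simp [qint] at h

lemma IsHitFamily.cons {φ : Polynomial ℤ →+* K} (hX : φ Polynomial.X ≠ 0)
    (hX1 : φ Polynomial.X ≠ 1) {l : List ℤ} {a : ℕ → Polynomial ℤ} (ha : IsHitFamily φ l a) {d : ℤ}
    (hlo : ∀ j : ℕ, a j ≠ 0 → d - 1 ≤ j) (hhi : ∀ j : ℕ, a j ≠ 0 → (j : ℤ) ≤ l.length + d) :
    IsHitFamily φ (d :: l) fun j => hitLower l.length d a j + hitUpper l.length d a j := by
  have hcases : ∀ j, hitLower l.length d a j + hitUpper l.length d a j ≠ 0 →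
      (1 ≤ j ∧ a (j - 1) ≠ 0 ∧ (j : ℤ) ≤ d + l.length) ∨ (a j ≠ 0 ∧ d ≤ j) := by
    intro j h
    by_cases h1 : hitLower l.length d a j = 0
    · exact Or.inr (hitUpper_ne_zero fun h2 => h (by rw [h1, h2, add_zero]))
    · exact Or.inl (hitLower_ne_zero h1)
  have hU : ∀ j : ℕ, φ (hitUpper l.length d a j) = φ Polynomial.X ^ (d + l.length - j)
      * ((1 - φ Polynomial.X ^ (1 + j - d)) / (1 - φ Polynomial.X)) * φ (a j) := by
    intro j
    by_cases h : a j = 0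
    · simp [hitUpper, h]
    have h1 := hlo j h
    have h2 := hhi j h
    rw [hitUpper, map_mul, map_mul, map_qint, map_pow, qint_toNat_eq_div hX1 (by omega),
      ← zpow_natCast, Int.toNat_of_nonneg (by omega), mul_assoc]
  refine ⟨fun j => ?_, fun j => ?_, fun j hj => ?_, fun v hv hv1 j hj => ?_,
    fun v hv hv1 j hj => ?_⟩
  · rw [hitList, map_add, hU]
    cases j with
    | zero =>
      rw [hitStep_coeff_zero hX, ha.coeff_eq]
      simp [hitLower]
    | succ j =>
      rw [hitStep_coeff_succ hX, ha.coeff_eq, ha.coeff_eq]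
      congr 1
      · rw [hitLower, if_neg (Nat.succ_ne_zero j), Nat.add_sub_cancel, map_mul, map_qint]
        by_cases h : a j = 0
        · simp [h]
        have h2 := hhi j h
        rw [qint_toNat_eq_div hX1 (by push_cast; omega),
          show d + l.length + 1 - ((j + 1 : ℕ) : ℤ) = d + l.length - j by push_cast; ring]
      · push_cast
        rw [show (1 : ℤ) + (j + 1) - d = 2 + j - d by ring]
  · refine SymmUnimodal.add ?_ ?_
    · by_cases h : hitLower l.length d a j = 0
      · rw [h]; exact SymmUnimodal.zero _
      obtain ⟨h1, h2, h3⟩ := hitLower_ne_zero h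
      have := (ha.symmUnimodal (j - 1)).qint_mul (d + l.length + 1 - j).toNat
      rw [hitLower, if_neg (by omega)]
      convert this using 1
      rw [Int.toNat_of_nonneg (by omega)]
      push_cast [h1, List.map_cons, List.sum_cons, List.length_cons]
      ring
    · by_cases h : hitUpper l.length d a j = 0
      · rw [h]; exact SymmUnimodal.zero _
      obtain ⟨h1, h2⟩ := hitUpper_ne_zero h
      have h3 := hhi j h1
      have := ((ha.symmUnimodal j).qint_mul (1 + j - d).toNat).X_pow_mul (d + l.length - j).toNat
      rw [hitUpper]
      convert this using 1
      rw [Int.toNat_of_nonneg (by omega), Int.toNat_of_nonneg (by omega)]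
      push_cast [List.map_cons, List.sum_cons, List.length_cons]
      ring
  · rw [List.length_cons]
    rcases hcases j hj with ⟨h1, h2, -⟩ | ⟨h1, -⟩
    · have := ha.le_length _ h2; omega
    · have := ha.le_length _ h1; omega
  · rcases List.mem_cons.1 hv with rfl | hv <;> rcases hcases j hj with ⟨h1, h2, -⟩ | ⟨h1, h2⟩
    · have := hlo _ h2; omega
    · exact h2
    · have := ha.le_of_pos v hv hv1 _ h2; omega
    · exact ha.le_of_pos v hv hv1 _ h1
  · rw [List.length_cons]
    push_cast
    rcases List.mem_cons.1 hv with rfl | hv <;> rcases hcases j hj with ⟨h1, h2, h3⟩ | ⟨h1, h2⟩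
    · linarith
    · have := hhi _ h1; linarith
    · have := ha.le_of_nonpos v hv hv1 _ h2; omega
    · have := ha.le_of_nonpos v hv hv1 _ h1; omega

/-- Among the entries of `l`, no value is skipped when moving towards `{0, 1}`. -/
def NoGaps (l : List ℤ) : Prop :=
  ∀ v ∈ l, (2 ≤ v → v - 1 ∈ l) ∧ (v ≤ -1 → v + 1 ∈ l)

lemma NoGaps.exists_isHitFamily {φ : Polynomial ℤ →+* K} (hX : φ Polynomial.X ≠ 0)
    (hX1 : φ Polynomial.X ≠ 1) {l : List ℤ} (hl : NoGaps l) : ∃ a, IsHitFamily φ l a := by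
  induction hm : l.length generalizing l with
  | zero =>
    obtain rfl := List.length_eq_zero_iff.1 hm
    exact ⟨_, IsHitFamily.nil φ⟩
  | succ m ih =>
    have hne : l.toFinset.Nonempty := by
      obtain ⟨v, hv⟩ := List.exists_mem_of_length_pos (l := l) (by omega)
      exact ⟨v, List.mem_toFinset.2 hv⟩
    by_cases hpos : ∃ v ∈ l, 1 ≤ v
    · obtain ⟨v, hv, hv1⟩ := hpos
      obtain ⟨d, hd, hmax⟩ := l.toFinset.exists_max_image id hne
      simp only [List.mem_toFinset, id] at hd hmax
      have hd1 : 1 ≤ d := hv1.trans (hmax v hv)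
      have hmem : ∀ w ∈ l, w ≠ d → w ∈ l.erase d := fun w hw h => (List.mem_erase_of_ne h).2 hw
      have hgap : NoGaps (l.erase d) := by
        intro w hw
        have hwl := List.mem_of_mem_erase hw
        have := hmax w hwl
        exact ⟨fun h => hmem _ ((hl w hwl).1 h) (by omega),
          fun h => hmem _ ((hl w hwl).2 h) (by omega)⟩
      obtain ⟨a, ha⟩ := ih hgap (by rw [List.length_erase_of_mem hd]; omega)
      refine ⟨_, (ha.cons hX hX1 (d := d) (fun j hj => ?_) fun j hj => ?_).perm hX
        (List.perm_cons_erase hd).symm⟩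
      · rcases hd1.eq_or_lt with h | h
        · omega
        · exact ha.le_of_pos _ (hmem _ ((hl d hd).1 h) (by omega)) (by omega) j hj
      · have := ha.le_length j hj
        omega
    · push Not at hpos
      obtain ⟨d, hd, hmin⟩ := l.toFinset.exists_min_image id hne
      simp only [List.mem_toFinset, id] at hd hmin
      have hd1 := hpos d hd
      have hmem : ∀ w ∈ l, w ≠ d → w ∈ l.erase d := fun w hw h => (List.mem_erase_of_ne h).2 hw
      have hgap : NoGaps (l.erase d) := by
        intro w hw
        have hwl := List.mem_of_mem_erase hw
        have := hmin w hwl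
        have := hpos w hwl
        exact ⟨fun h => by omega, fun h => hmem _ ((hl w hwl).2 h) (by omega)⟩
      obtain ⟨a, ha⟩ := ih hgap (by rw [List.length_erase_of_mem hd]; omega)
      refine ⟨_, (ha.cons hX hX1 (d := d) (fun j hj => ?_) fun j hj => ?_).perm hX
        (List.perm_cons_erase hd).symm⟩
      · omega
      · rcases eq_or_ne d 0 with h | h
        · have := ha.le_length j hj
          omega
        · have := ha.le_of_nonpos _ (hmem _ ((hl d hd).2 (by omega)) (by omega)) (by omega) j hj
          omega

end Positivity

section Board

variable {n : ℕ}

/-- The height of column `i` of the board `c`, minus `i` (zero outside the board). -/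
def shiftedHeight (c : Fin n → ℕ) (i : ℕ) : ℤ := if h : i < n then (c ⟨i, h⟩ : ℤ) - i else 0

/-- The shifted heights of the first `m` columns of the board `c`, in reverse order. -/
def shiftedHeights (c : Fin n → ℕ) (m : ℕ) : List ℤ :=
  ((List.range m).map (shiftedHeight c)).reverse

lemma shiftedHeights_succ (c : Fin n → ℕ) (m : ℕ) :
    shiftedHeights c (m + 1) = shiftedHeight c m :: shiftedHeights c m := by
  simp [shiftedHeights, List.range_succ]

lemma length_shiftedHeights (c : Fin n → ℕ) (m : ℕ) : (shiftedHeights c m).length = m := by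
  simp [shiftedHeights]

lemma mem_shiftedHeights {c : Fin n → ℕ} {m : ℕ} {v : ℤ} :
    v ∈ shiftedHeights c m ↔ ∃ i < m, shiftedHeight c i = v := by
  simp [shiftedHeights]

lemma truncHitGen_eq_hitList {K : Type*} [Field K] {q : K} (hq : q ≠ 0) (hq1 : q ≠ 1)
    {c : Fin n → ℕ} (hc : IsFerrers n c) {m : ℕ} (hm : m ≤ n) :
    truncHitGen q c m = hitList q (shiftedHeights c m) := by
  induction m with
  | zero =>
    simp [truncHitGen, shiftedHeights, hitList, qRook_truncCols_zero, qfact, hitBasis]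
  | succ m ih =>
    rw [truncHitGen_succ hq hq1 hc hm, ih (by omega), shiftedHeights_succ, hitList,
      length_shiftedHeights, shiftedHeight, dif_pos (show m < n from hm)]

lemma noGaps_shiftedHeights {c : Fin n → ℕ} (hc : IsFerrers n c) :
    NoGaps (shiftedHeights c n) := by
  have hstep : ∀ i, i + 1 < n → shiftedHeight c i - 1 ≤ shiftedHeight c (i + 1) := by
    intro i hi
    have := hc.1 (show (⟨i, by omega⟩ : Fin n) ≤ ⟨i + 1, hi⟩ from Nat.le_succ i)
    rw [shiftedHeight, shiftedHeight, dif_pos hi, dif_pos (by omega)]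
    push_cast
    omega
  have hfirst : 0 ≤ shiftedHeight c 0 := by
    unfold shiftedHeight
    split_ifs <;> simp
  have hlast : ∀ i, i + 1 = n → shiftedHeight c i ≤ 1 := by
    intro i hi
    have := hc.2 ⟨i, by omega⟩
    rw [shiftedHeight, dif_pos (by omega)]
    omega
  have hdown : ∀ w : ℤ, 1 ≤ w → ∀ t i, i + t + 1 = n → w ≤ shiftedHeight c i →
      ∃ i' < n, shiftedHeight c i' = w := by
    intro w hw t
    induction t with
    | zero =>
      intro i hi h
      have := hlast i hi
      exact ⟨i, by omega, by omega⟩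
    | succ t ih =>
      intro i hi h
      rcases h.eq_or_lt with h | h
      · exact ⟨i, by omega, h.symm⟩
      · have := hstep i (by omega)
        exact ih (i + 1) (by omega) (by omega)
  have hup : ∀ w : ℤ, w ≤ 0 → ∀ i < n, shiftedHeight c i ≤ w →
      ∃ i' < n, shiftedHeight c i' = w := by
    intro w hw i
    induction i with
    | zero => exact fun hi h => ⟨0, hi, by omega⟩
    | succ i ih =>
      intro hi h
      rcases h.eq_or_lt with h | h
      · exact ⟨i + 1, hi, h⟩
      · have := hstep i hi
        exact ih (by omega) (by omega)
  intro v hv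
  obtain ⟨i, hi, rfl⟩ := mem_shiftedHeights.1 hv
  exact ⟨fun h => mem_shiftedHeights.2 (hdown _ (by omega) (n - i - 1) i (by omega) (by omega)),
    fun h => mem_shiftedHeights.2 (hup _ (by omega) i hi (by omega))⟩

lemma sum_shiftedHeights (c : Fin n → ℕ) :
    ((shiftedHeights c n).map fun d => d - 1).sum = ∑ j, (c j : ℤ) - (n + 1).choose 2 := by
  have h : ∀ m, ((shiftedHeights c m).map fun d => d - 1).sum
      = ∑ i ∈ Finset.range m, (shiftedHeight c i - 1) := by
    intro m
    induction m with
    | zero => simp [shiftedHeights]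
    | succ m ih =>
      rw [shiftedHeights_succ, List.map_cons, List.sum_cons, ih, Finset.sum_range_succ, add_comm]
  have hg : ∀ m : ℕ, ∑ i ∈ Finset.range m, ((i : ℤ) + 1) = (m + 1).choose 2 := by
    intro m
    induction m with
    | zero => simp
    | succ m ih =>
      rw [Finset.sum_range_succ, ih, Nat.choose_succ_succ (m + 1) 1, Nat.choose_one_right]
      push_cast
      ring
  rw [h, ← hg, Finset.sum_range, Finset.sum_range, ← Finset.sum_sub_distrib]
  refine Finset.sum_congr rfl fun j _ => ?_
  rw [shiftedHeight, dif_pos j.2]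
  ring

lemma map_qHit {R S : Type*} [CommRing R] [CommRing S] (φ : R →+* S) (q : R) (n : ℕ)
    (c : Fin n → ℕ) (k : ℕ) : φ (qHit q n c k) = qHit (φ q) n c k := by
  rw [qHit, qHit, ← Polynomial.coeff_map]
  congr 1
  simp [hitGen, qfact, qint, qRook, Polynomial.map_sum, Polynomial.map_prod]

end Board

theorem statement16 (n : ℕ) (c : Fin n → ℕ) (hc : IsFerrers n c) (k : ℕ) (hk : k ≤ n) :
    ZSUZ (qHit (Polynomial.X : Polynomial ℤ) n c k)
      ((∑ j, (c j : ℤ)) + (n : ℤ) * ((n : ℤ) - k) - (n + 1).choose 2) := by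
  let φ := algebraMap (Polynomial ℤ) (FractionRing (Polynomial ℤ))
  have hφ : Function.Injective φ := IsFractionRing.injective _ _
  have hX : φ Polynomial.X ≠ 0 := fun h =>
    Polynomial.X_ne_zero (hφ (h.trans (map_zero φ).symm))
  have hX1 : φ Polynomial.X ≠ 1 := fun h =>
    Polynomial.X_ne_C (1 : ℤ) (hφ (h.trans (map_one φ).symm))
  obtain ⟨a, ha⟩ := (noGaps_shiftedHeights hc).exists_isHitFamily hX hX1
  have hgen : hitGen (φ Polynomial.X) n c = hitList (φ Polynomial.X) (shiftedHeights c n) := by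
    rw [← truncHitGen_eq_hitList hX hX1 hc le_rfl, truncHitGen, truncCols_self]
    rfl
  have hak : qHit Polynomial.X n c k = a k := by
    apply hφ
    rw [map_qHit, qHit, hgen, ha.coeff_eq]
  rw [hak]
  convert (ha.symmUnimodal k).zsuz using 1
  rw [sum_shiftedHeights, length_shiftedHeights]
  ring
end
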